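/- arXiv:1006.2671 — 3 statements merged into one kernel-verified Lean document; each statement's English description precedes it below -/
import Mathlib

section
/- (Finite version of the density Halpern–Läuchli Theorem.) For every 0 < ε ≤ 1, every integer k ≥ 1 and all integers b_1,…,b_d ≥ 2 there exists N ∈ ℕ with the following property: for every n > N and every subset D of ⋃_{m=0}^{n−1} b_1^m×⋯×b_d^m satisfying |D ∩ (b_1^m×⋯×b_d^m)| ≥ ε |b_1^m×⋯×b_d^m| for every m ∈ {0,…,n−1}, there exists a vector strong subtree (S_1,…,S_d) of (b_1^{<n},…,b_d^{<n}) of height k such that ⋃_{m=0}^{k−1} S_1(m)×⋯×S_d(m) ⊆ D. -/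
open Filter

namespace DHLPaper

/-- The tree `b^{<ℕ}` of all finite sequences with values in `{0,…,b−1}`,
partially ordered by end-extension (`List.IsPrefix`, written `<+:`). -/
def bSeq (b : ℕ) : Set (List ℕ) := {t | ∀ x ∈ t, x < b}

/-- The set of successors of `t` in `T`: `Suc_T(t) = {s ∈ T : t ≤ s}`. -/
def suc (T : Set (List ℕ)) (t : List ℕ) : Set (List ℕ) := {s ∈ T | t <+: s}

/-- `s` is an immediate successor of `t` in `T`. -/
def ImmSuc (T : Set (List ℕ)) (t s : List ℕ) : Prop :=
  t ∈ T ∧ s ∈ T ∧ t <+: s ∧ t ≠ s ∧ ∀ u ∈ T, t <+: u → u <+: s → u = t ∨ u = s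

/-- The `n`-th level of `T`: the nodes of `T` with exactly `n` strict predecessors in `T`. -/
def level (T : Set (List ℕ)) (n : ℕ) : Set (List ℕ) :=
  {t ∈ T | {s ∈ T | s <+: t ∧ s ≠ t}.ncard = n}

/-- `T` has exactly one minimal node. -/
def UniquelyRooted (T : Set (List ℕ)) : Prop := ∃! r, r ∈ level T 0

/-- Every node of `T` has finitely many immediate successors in `T`. -/
def FinitelyBranching (T : Set (List ℕ)) : Prop := ∀ t ∈ T, {s | ImmSuc T t s}.Finite

/-- Every node of `T` has at least one immediate successor in `T`. -/
def Pruned (T : Set (List ℕ)) : Prop := ∀ t ∈ T, ∃ s, ImmSuc T t s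

/-- `S` is a strong subtree of `T` whose level set `L_T(S)` is enumerated by the strictly
increasing map `l`: `S(n) ⊆ T(l n)` for every `n`, `S` is uniquely rooted, and for every
`s ∈ S` and every immediate successor `t` of `s` in `T` there is a unique immediate
successor `s'` of `s` in `S` with `t ≤ s'`. -/
def IsStrongSubtreeWith (T S : Set (List ℕ)) (l : ℕ → ℕ) : Prop :=
  S ⊆ T ∧ UniquelyRooted S ∧ StrictMono l ∧
    (∀ n, level S n ⊆ level T (l n)) ∧
    (∀ s ∈ S, ∀ t, ImmSuc T s t → ∃! s', ImmSuc S s s' ∧ t <+: s')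

/-- `S` is a strong subtree of `T`. -/
def IsStrongSubtree (T S : Set (List ℕ)) : Prop := ∃ l, IsStrongSubtreeWith T S l

/-- A homogeneous tree with branching number `b`: a strong subtree of `b^{<ℕ}`, `b ≥ 2`. -/
def IsHomogeneous (b : ℕ) (T : Set (List ℕ)) : Prop := 2 ≤ b ∧ IsStrongSubtree (bSeq b) T

/-- A vector homogeneous tree: a `d`-tuple of homogeneous trees. -/
def IsVecHomogeneous {d : ℕ} (b : Fin d → ℕ) (T : Fin d → Set (List ℕ)) : Prop :=
  ∀ i, IsHomogeneous (b i) (T i)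

/-- Vector strong subtree: componentwise strong subtrees with a common level set. -/
def IsVecStrongSubtree {d : ℕ} (T S : Fin d → Set (List ℕ)) : Prop :=
  ∃ l, ∀ i, IsStrongSubtreeWith (T i) (S i) l

/-- `⊗T(n) = T_1(n) × ⋯ × T_d(n)`. -/
def vecLevel {d : ℕ} (T : Fin d → Set (List ℕ)) (n : ℕ) : Set (Fin d → List ℕ) :=
  {v | ∀ i, v i ∈ level (T i) n}

/-- The level product `⊗T = ⋃_n ⊗T(n)`. -/
def levelProd {d : ℕ} (T : Fin d → Set (List ℕ)) : Set (Fin d → List ℕ) :=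
  ⋃ n, vecLevel T n

/-- `r` is the root tuple of the vector tree `T`. -/
def IsRoot {d : ℕ} (T : Fin d → Set (List ℕ)) (r : Fin d → List ℕ) : Prop :=
  ∀ i, level (T i) 0 = {r i}

/-- `F` is a vector fan of `T`: `F = (R_1(0) ∪ R_1(1), …, R_d(0) ∪ R_d(1))` for some
vector strong subtree `R` of `T`. -/
def IsVecFan {d : ℕ} (T F : Fin d → Set (List ℕ)) : Prop :=
  ∃ R : Fin d → Set (List ℕ), IsVecStrongSubtree T R ∧
    ∀ i, F i = level (R i) 0 ∪ level (R i) 1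

/-- `fan(T,n)`: the vector fans of `T` with `⊗F(1) ⊆ ⊗T(n)`. -/
def fanAt {d : ℕ} (T : Fin d → Set (List ℕ)) (n : ℕ) : Set (Fin d → Set (List ℕ)) :=
  {F | IsVecFan T F ∧ vecLevel F 1 ⊆ vecLevel T n}

/-- Density of `F ⊆ W(n)` in the `n`-th level of `W`. -/
noncomputable def dens (W : Set (List ℕ)) (n : ℕ) (F : Set (List ℕ)) : ℝ :=
  (F.ncard : ℝ) / ((level W n).ncard : ℝ)

/-- Density of `F ⊆ W(n)` relative to the node `w`. -/
noncomputable def densRel (W : Set (List ℕ)) (n : ℕ) (F : Set (List ℕ)) (w : List ℕ) : ℝ :=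
  ((F ∩ suc W w).ncard : ℝ) / ((level W n ∩ suc W w).ncard : ℝ)

/-- `s = w ⌢_W p`: `s` is the immediate successor of `w` in `W` such that the
concatenation `w ⌢ p` is an initial segment of `s`. -/
def IsConcat (W : Set (List ℕ)) (w : List ℕ) (p : ℕ) (s : List ℕ) : Prop :=
  ImmSuc W w s ∧ w ++ [p] <+: s

/-- The density Halpern–Läuchli statement in dimension `d`. -/
def DHL (d : ℕ) : Prop :=
  ∀ (b : Fin d → ℕ) (T : Fin d → Set (List ℕ)), IsVecHomogeneous b T →
    ∀ D : Set (Fin d → List ℕ), D ⊆ levelProd T →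
      0 < Filter.limsup
          (fun n => ((D ∩ vecLevel T n).ncard : ℝ) / ((vecLevel T n).ncard : ℝ)) atTop →
      ∃ S : Fin d → Set (List ℕ), IsVecStrongSubtree T S ∧ levelProd S ⊆ D

/-- `D : ⊗T → 2^W` is an `ε`-dense level selection along the strictly increasing
sequence `l`: for every `n` and every `t⃗ ∈ ⊗T(n)`, `D(t⃗) ⊆ W(l n)` and
`dens(D(t⃗)) ≥ ε`. -/
def IsDenseLevelSel {d : ℕ} (T : Fin d → Set (List ℕ)) (W : Set (List ℕ)) (l : ℕ → ℕ)
    (ε : ℝ) (D : (Fin d → List ℕ) → Set (List ℕ)) : Prop :=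
  StrictMono l ∧ ∀ n, ∀ v ∈ vecLevel T n, D v ⊆ level W (l n) ∧ ε ≤ dens W (l n) (D v)

/-- The pair `(R, w)` (`R` a vector strong subtree of `T` with root tuple `r0`) is strongly
`θ`-correlated with respect to the dense level selection `D` (with level sequence `l`):
`w ∈ D(r0)` and for every vector fan `F` of `R` with `F(0) = r0` and every `p < b_W`,
`dens(⋂_{r ∈ ⊗F(1)} D(r) | w ⌢_W p) ≥ θ`. -/
def StronglyCorrelated {d : ℕ} (T : Fin d → Set (List ℕ)) (W : Set (List ℕ)) (bW : ℕ)
    (l : ℕ → ℕ) (D : (Fin d → List ℕ) → Set (List ℕ)) (R : Fin d → Set (List ℕ))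
    (r0 : Fin d → List ℕ) (w : List ℕ) (θ : ℝ) : Prop :=
  w ∈ D r0 ∧
    ∀ F : Fin d → Set (List ℕ), IsVecFan R F → IsRoot F r0 →
      ∀ n, vecLevel F 1 ⊆ vecLevel T n →
        ∀ p < bW, ∀ s, IsConcat W w p s →
          θ ≤ densRel W (l n) (⋂ r ∈ vecLevel F 1, D r) s

/-- The `0`-`1` value of a proposition. -/
noncomputable def ind (p : Prop) : ℝ := open Classical in if p then 1 else 0

lemma ind_true {p : Prop} (h : p) : ind p = 1 := by simp [ind, h]

lemma ind_false {p : Prop} (h : ¬p) : ind p = 0 := by simp [ind, h]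

lemma ind_nonneg (p : Prop) : 0 ≤ ind p := by
  by_cases h : p <;> simp [ind, h]

lemma ind_le_one (p : Prop) : ind p ≤ 1 := by
  by_cases h : p <;> simp [ind, h]

lemma ind_mono {p q : Prop} (h : p → q) : ind p ≤ ind q := by
  by_cases hp : p
  · rw [ind_true hp, ind_true (h hp)]
  · rw [ind_false hp]; exact ind_nonneg q

/-- The average of `φ` over the words of length `m`. -/
noncomputable def mean {B : Type} [Fintype B] : ℕ → (List B → ℝ) → ℝ
  | 0, φ => φ []
  | m + 1, φ => (∑ a, mean m (fun s => φ (a :: s))) / Fintype.card B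

section Mean

variable {B : Type} [Fintype B]

lemma mean_mono (m : ℕ) {φ ψ : List B → ℝ} (h : ∀ s, s.length = m → φ s ≤ ψ s) :
    mean m φ ≤ mean m ψ := by
  induction m generalizing φ ψ with
  | zero => exact h [] rfl
  | succ m ih =>
    unfold mean
    gcongr with a
    exact ih fun s hs => h _ (by simp [hs])

lemma mean_congr (m : ℕ) {φ ψ : List B → ℝ} (h : ∀ s, s.length = m → φ s = ψ s) :
    mean m φ = mean m ψ :=
  le_antisymm (mean_mono m fun s hs => (h s hs).le) (mean_mono m fun s hs => (h s hs).ge)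

lemma mean_sum {κ : Type} (m : ℕ) (t : Finset κ) (φ : κ → List B → ℝ) :
    mean m (fun s => ∑ k ∈ t, φ k s) = ∑ k ∈ t, mean m (φ k) := by
  induction m generalizing φ with
  | zero => rfl
  | succ m ih =>
    unfold mean
    rw [← Finset.sum_div, Finset.sum_comm]
    simp only [ih]

lemma mean_const_mul (m : ℕ) (c : ℝ) (φ : List B → ℝ) :
    mean m (fun s => c * φ s) = c * mean m φ := by
  induction m generalizing φ with
  | zero => rfl
  | succ m ih =>
    unfold mean
    simp only [ih]
    rw [← Finset.mul_sum, mul_div_assoc]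

lemma mean_div (m : ℕ) (c : ℝ) (φ : List B → ℝ) :
    mean m (fun s => φ s / c) = mean m φ / c := by
  simp only [div_eq_inv_mul, mean_const_mul]

lemma mean_sub (m : ℕ) (φ ψ : List B → ℝ) :
    mean m (fun s => φ s - ψ s) = mean m φ - mean m ψ := by
  induction m generalizing φ ψ with
  | zero => rfl
  | succ m ih =>
    unfold mean
    simp only [ih]
    rw [Finset.sum_sub_distrib, sub_div]

lemma mean_const [Nonempty B] (m : ℕ) (c : ℝ) : mean m (fun _ : List B => c) = c := by
  induction m with
  | zero => rfl
  | succ m ih =>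
    unfold mean
    simp only [ih]
    simp

lemma mean_append (j m : ℕ) (φ : List B → ℝ) :
    mean (j + m) φ = mean j (fun u => mean m (fun s => φ (u ++ s))) := by
  induction j generalizing φ with
  | zero => simp [mean]
  | succ j ih =>
    rw [show j + 1 + m = (j + m) + 1 by ring]
    simp only [mean, ih, List.cons_append]

lemma mean_comm {C : Type} [Fintype C] (m n : ℕ) (φ : List B → List C → ℝ) :
    mean m (fun s => mean n (fun t => φ s t)) = mean n (fun t => mean m (fun s => φ s t)) := by
  induction m generalizing φ with
  | zero => rfl
  | succ m ih =>
    simp only [mean, ih]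
    rw [← mean_sum, mean_div]

lemma mean_nonneg (m : ℕ) {φ : List B → ℝ} (h : ∀ s, 0 ≤ φ s) : 0 ≤ mean m φ := by
  induction m generalizing φ with
  | zero => exact h []
  | succ m ih =>
    unfold mean
    exact div_nonneg (Finset.sum_nonneg fun a _ => ih fun s => h _) (by positivity)

lemma mean_le_of_le [Nonempty B] (m : ℕ) {φ : List B → ℝ} {c : ℝ}
    (h : ∀ s, s.length = m → φ s ≤ c) : mean m φ ≤ c :=
  (mean_mono m h).trans (mean_const m c).le

lemma mean_ind_le_one [Nonempty B] (m : ℕ) (p : List B → Prop) :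
    mean m (fun s => ind (p s)) ≤ 1 :=
  mean_le_of_le m fun _ _ => ind_le_one _

/-- Averages over words in a product alphabet of functions of product form. -/
lemma mean_prod {J : Type} [Fintype J] [DecidableEq J] [Nonempty B] (m : ℕ) (φ : J → List B → ℝ) :
    mean m (fun y : List (J → B) => ∏ j, φ j (y.map fun a => a j)) = ∏ j, mean m (φ j) := by
  induction m generalizing φ with
  | zero => rfl
  | succ m ih =>
    simp only [mean, List.map_cons]
    rw [Finset.prod_div_distrib, Fintype.prod_sum]
    congr 1
    · exact Finset.sum_congr rfl fun x _ => ih fun j s => φ j (x j :: s)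
    · simp

lemma ncard_words_eq_mean (m : ℕ) [Nonempty B] (p : List B → Prop) :
    ({s : List B | s.length = m ∧ p s}.ncard : ℝ) =
      mean m (fun s => ind (p s)) * (Fintype.card B : ℝ) ^ m := by
  induction m generalizing p with
  | zero =>
    by_cases h : p []
    · have : {s : List B | s.length = 0 ∧ p s} = {[]} := by
        ext s; simp only [List.length_eq_zero_iff, Set.mem_ofPred_eq, Set.mem_singleton_iff]
        exact ⟨fun h => h.1, fun h' => ⟨h', h' ▸ h⟩⟩
      rw [this]; simp [mean, ind_true h]
    · have : {s : List B | s.length = 0 ∧ p s} = ∅ := by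
        ext s; simp only [List.length_eq_zero_iff, Set.mem_ofPred_eq, Set.mem_empty_iff_false,
          iff_false, not_and]
        rintro rfl; exact h
      rw [this]; simp [mean, ind_false h]
  | succ m ih =>
    have hB : (Fintype.card B : ℝ) ≠ 0 := by simp
    have hset : {s : List B | s.length = m + 1 ∧ p s} =
        ⋃ a : B, (fun s => a :: s) '' {s : List B | s.length = m ∧ p (a :: s)} := by
      ext s
      cases s <;> simp
    have hfin : ∀ a : B, {s : List B | s.length = m ∧ p (a :: s)}.Finite := fun a =>
      (List.finite_length_eq B m).subset fun s hs => hs.1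
    rw [hset, Set.ncard_iUnion_of_finite fun a => (hfin a).image _, finsum_eq_sum_of_fintype]
    · simp only [Set.ncard_image_of_injective _ (List.cons_injective)]
      push_cast
      simp only [ih]
      rw [← Finset.sum_mul]
      simp only [mean]
      field_simp
      ring
    · intro a a' haa
      rw [Function.onFun, Set.disjoint_left]
      rintro _ ⟨s, -, rfl⟩ ⟨t, -, ht⟩
      exact haa (List.cons.inj ht).1.symm

end Mean

section Strong

variable {ι : Type} {A : ι → Type}

/-- The `i`-th coordinate of a word in a product alphabet. -/
def pr (i : ι) (x : List (∀ i, A i)) : List (A i) := x.map fun a => a i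

@[simp] lemma pr_nil (i : ι) : pr i ([] : List (∀ i, A i)) = [] := rfl

@[simp] lemma pr_cons (i : ι) (a : ∀ i, A i) (x : List (∀ i, A i)) :
    pr i (a :: x) = a i :: pr i x := rfl

@[simp] lemma pr_append (i : ι) (x y : List (∀ i, A i)) : pr i (x ++ y) = pr i x ++ pr i y :=
  List.map_append

@[simp] lemma length_pr (i : ι) (x : List (∀ i, A i)) : (pr i x).length = x.length :=
  List.length_map _

lemma pr_take (i : ι) (n : ℕ) (x : List (∀ i, A i)) : pr i (x.take n) = (pr i x).take n :=
  List.map_take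

lemma pr_drop (i : ι) (n : ℕ) (x : List (∀ i, A i)) : pr i (x.drop n) = (pr i x).drop n :=
  List.map_drop

/-- A self-map of the level product of the trees of words over the alphabets `A i` which
describes a vector strong subtree: `F x` is the node of the subtree corresponding to `x`. -/
structure Strong (F : List (∀ i, A i) → List (∀ i, A i)) : Prop where
  len : ∀ x y, x.length = y.length → (F x).length = (F y).length
  ext : ∀ x a, F x ++ [a] <+: F (x ++ [a])
  loc : ∀ i x y, pr i x = pr i y → pr i (F x) = pr i (F y)

/-- A vector fan with root `x₀`: the set of nodes `x₀` and `φ p`. -/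
structure IsFan (x₀ : List (∀ i, A i)) (φ : (∀ i, A i) → List (∀ i, A i)) : Prop where
  len : ∀ p q, (φ p).length = (φ q).length
  ext : ∀ p, x₀ ++ [p] <+: φ p
  loc : ∀ i p q, p i = q i → pr i (φ p) = pr i (φ q)

namespace Strong

variable {F G : List (∀ i, A i) → List (∀ i, A i)}

lemma append_prefix (hF : Strong F) (x : List (∀ i, A i)) (r : List (∀ i, A i)) :
    F x <+: F (x ++ r) := by
  induction r using List.reverseRecOn with
  | nil => simp
  | append_singleton r a ih =>
    rw [← List.append_assoc]
    exact ih.trans ((List.prefix_append _ _).trans (hF.ext _ a))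

lemma mono (hF : Strong F) {x y : List (∀ i, A i)} (h : x <+: y) : F x <+: F y := by
  obtain ⟨r, rfl⟩ := h
  exact hF.append_prefix x r

lemma ext_append (hF : Strong F) (x : List (∀ i, A i)) (a : ∀ i, A i)
    (r : List (∀ i, A i)) : F x ++ [a] <+: F (x ++ a :: r) :=
  (hF.ext x a).trans (hF.mono (by simp))

protected lemma id : Strong (fun x : List (∀ i, A i) => x) :=
  ⟨fun _ _ h => h, fun _ _ => List.prefix_rfl, fun _ _ _ h => h⟩

lemma comp (hF : Strong F) (hG : Strong G) : Strong (fun x => F (G x)) where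
  len _ _ h := hF.len _ _ (hG.len _ _ h)
  ext x a := (hF.ext _ a).trans (hF.mono (hG.ext x a))
  loc _ _ _ h := hF.loc _ _ _ (hG.loc _ _ _ h)

lemma translate (u : List (∀ i, A i)) : Strong (fun x => u ++ x) where
  len x y h := by simp [h]
  ext x a := by simp
  loc i x y h := by simp [h]

lemma length_lt (hF : Strong F) {x y : List (∀ i, A i)}
    (h : x.length < y.length) : (F x).length < (F y).length := by
  obtain ⟨a, r, hr⟩ : ∃ a r, y.drop x.length = a :: r := by
    cases hd : y.drop x.length with
    | nil => rw [List.drop_eq_nil_iff] at hd; omega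
    | cons a r => exact ⟨a, r, rfl⟩
  have h1 := hF.ext_append (y.take x.length) a r
  rw [← hr, List.take_append_drop] at h1
  have h2 := h1.length_le
  have h3 := hF.len x (y.take x.length) (by simp; omega)
  simp at h2
  omega

lemma exists_levels (hF : Strong F) [Nonempty (∀ i, A i)] :
    ∃ h : ℕ → ℕ, StrictMono h ∧ ∀ x, (F x).length = h x.length := by
  obtain ⟨a⟩ := ‹Nonempty (∀ i, A i)›
  refine ⟨fun n => (F (List.replicate n a)).length, fun m n h => ?_, fun x => ?_⟩
  · exact hF.length_lt (by simpa using h)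
  · exact hF.len _ _ (by simp)

lemma fan_map (hF : Strong F) {x₀ : List (∀ i, A i)} {φ : (∀ i, A i) → List (∀ i, A i)}
    (hφ : IsFan x₀ φ) : IsFan (F x₀) (fun p => F (φ p)) where
  len p q := hF.len _ _ (hφ.len p q)
  ext p := (hF.ext x₀ p).trans (hF.mono (hφ.ext p))
  loc i p q h := hF.loc _ _ _ (hφ.loc i p q h)

end Strong

lemma isFan_cons (x r : List (∀ i, A i)) : IsFan x (fun p => x ++ p :: r) where
  len p q := by simp
  ext p := by simp
  loc i p q h := by simp [h]

end Strong

section Colouring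

/-- A minimal closed left ideal of a compact semigroup: its idempotents act on it on the right
as the identity. -/
lemma exists_minimal_left_ideal {M : Type} [Nonempty M] [Semigroup M] [TopologicalSpace M]
    [CompactSpace M] [T2Space M] (hc : ∀ r : M, Continuous (· * r)) :
    ∃ L : Set M, L.Nonempty ∧ (∀ x, ∀ z ∈ L, x * z ∈ L) ∧
      ∀ q ∈ L, q * q = q → ∀ z ∈ L, z * q = z := by
  let S : Set (Set M) := {N | IsClosed N ∧ N.Nonempty ∧ ∀ x, ∀ z ∈ N, x * z ∈ N}
  obtain ⟨L, hL⟩ : ∃ L, Minimal (· ∈ S) L := by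
    refine zorn_superset _ fun c hcs hc => ?_
    refine ⟨⋂₀ c, ⟨isClosed_sInter fun t ht => (hcs ht).1, ?_, fun x z hz => ?_⟩, fun s hs =>
      Set.sInter_subset_of_mem hs⟩
    · obtain rfl | hcnemp := c.eq_empty_or_nonempty
      · rw [Set.sInter_empty]
        exact Set.univ_nonempty
      rw [Set.sInter_eq_iInter]
      exact @IsCompact.nonempty_iInter_of_directed_nonempty_isCompact_isClosed _ _ _
        hcnemp.coe_sort ((↑) : c → Set M) (DirectedOn.directed_val (IsChain.directedOn hc.symm))
        (fun i => (hcs i.prop).2.1) (fun i => (hcs i.prop).1.isCompact)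
        (fun i => (hcs i.prop).1)
    · rw [Set.mem_sInter] at hz ⊢
      exact fun t ht => (hcs ht).2.2 x z (hz t ht)
  obtain ⟨L_closed, hne, L_mul⟩ := hL.prop
  refine ⟨L, hne, L_mul, fun q hq hqq z hz => ?_⟩
  have himage : (· * q) '' L = L := by
    apply hL.eq_of_subset
    · refine ⟨(hc q).isClosedMap _ L_closed, hne.image _, ?_⟩
      rintro x _ ⟨y, hy, rfl⟩
      exact ⟨x * y, L_mul x y hy, mul_assoc _ _ _⟩
    · rintro _ ⟨y, _, rfl⟩
      exact L_mul y q hq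
  rw [← himage] at hz
  obtain ⟨y, _, rfl⟩ := hz
  change y * q * q = y * q
  rw [mul_assoc, hqq]

attribute [local instance] Ultrafilter.mul Ultrafilter.semigroup

lemma ultrafilter_map_mul {M N : Type} [Mul M] [Mul N] (f : M →ₙ* N) (U V : Ultrafilter M) :
    (U * V).map f = U.map f * V.map f := by
  ext s
  change (∀ᶠ m in U, ∀ᶠ m' in V, f (m * m') ∈ s) ↔
    (∀ᶠ m in U, ∀ᶠ m' in V, f m * f m' ∈ s)
  simp only [map_mul]

variable {B : Type}

/-- The substitution of a letter for the variable of a variable word. -/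
def subst (a : B) (w : List (Option B)) : List B := w.map fun o => o.getD a

/-- Left variable words: those whose first letter is the variable. -/
def leftVariable (B : Type) : Set (List (Option B)) := {w | ∃ v, w = none :: v}

/-- The recursive step of the Carlson–Simpson theorem. -/
lemma exists_recurrent_colour_class [Finite B] [Nonempty B] {κ : Type} [Finite κ]
    (c : List B → κ) :
    ∃ (k : κ) (P : Set (List B)), P.Nonempty ∧ (∀ x ∈ P, c x = k) ∧
      ∀ E : Set (List B), E.Finite → E ⊆ P →
        ∃ w ∈ leftVariable B, ∀ x ∈ E, ∀ a, x ++ subst a w ∈ P := by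
  obtain ⟨L, ⟨e, he⟩, L_mul, L_id⟩ := exists_minimal_left_ideal (M := Ultrafilter (FreeMonoid B))
    Ultrafilter.continuous_mul_left
  let ê : Ultrafilter (FreeMonoid (Option B)) := e.map (FreeMonoid.map some)
  let V : Set (FreeMonoid (Option B)) := leftVariable B
  have hV : ∀ w ∈ V, ∀ v : FreeMonoid (Option B), w * v ∈ V := by
    rintro _ ⟨w, rfl⟩ v
    exact ⟨w ++ v.toList, rfl⟩
  have hVmul : ∀ X Y : Ultrafilter (FreeMonoid (Option B)), V ∈ X → V ∈ X * Y := by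
    intro X Y hX
    change ∀ᶠ m in X, ∀ᶠ m' in Y, m * m' ∈ V
    filter_upwards [hX] with m hm
    exact Eventually.of_forall fun m' => hV m hm m'
  let σ : B → FreeMonoid (Option B) →* FreeMonoid B := fun a => FreeMonoid.map fun o => o.getD a
  obtain ⟨q, ⟨X, hX, rfl⟩, hqq⟩ := exists_idempotent_in_compact_subsemigroup
    (M := Ultrafilter (FreeMonoid (Option B))) Ultrafilter.continuous_mul_left
    ((· * ê) '' {X | V ∈ X})
    (Set.Nonempty.image _ ⟨pure [none], ⟨[], rfl⟩⟩)
    ((ultrafilter_isClosed_basic V).isCompact.image (Ultrafilter.continuous_mul_left ê))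
    (by
      rintro _ ⟨X, hX, rfl⟩ _ ⟨Y, hY, rfl⟩
      exact ⟨X * ê * Y, by rw [Set.mem_ofPred_eq, mul_assoc]; exact hVmul _ _ hX,
        mul_assoc _ _ _⟩)
  set q := X * ê
  have hσ : ∀ a, q.map (σ a) = X.map (σ a) * e := by
    intro a
    have h1 := ultrafilter_map_mul (σ a : FreeMonoid (Option B) →ₙ* FreeMonoid B) X ê
    have h2 : ê.map (σ a) = e := by
      rw [Ultrafilter.map_map]
      convert Ultrafilter.map_id e
      ext x
      change List.map _ (List.map _ x.toList) = x.toList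
      rw [List.map_map]
      exact List.map_id _
    exact h1.trans (congrArg (X.map (σ a) * ·) h2)
  have hσL : ∀ a, q.map (σ a) ∈ L := fun a => hσ a ▸ L_mul _ _ he
  have hσq : ∀ a, q.map (σ a) * q.map (σ a) = q.map (σ a) := fun a =>
    (ultrafilter_map_mul (σ a : FreeMonoid (Option B) →ₙ* FreeMonoid B) q q).symm.trans
      (congrArg (Ultrafilter.map (σ a)) hqq)
  have hid : ∀ z ∈ L, ∀ a, z * q.map (σ a) = z := fun z hz a => L_id _ (hσL a) (hσq a) z hz
  let g : FreeMonoid B → κ := fun x => c x.toList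
  obtain ⟨k, hk⟩ : ∃ k, ∀ᶠ x in e, g x = k := by
    have h : ∀ᶠ x in e, ∃ k, g x = k := Eventually.of_forall fun x => ⟨_, rfl⟩
    exact Ultrafilter.eventually_exists_iff.mp h
  let δ : Set (FreeMonoid B) := {x | ∀ᶠ w in q, ∀ a, g (x * σ a w) = k}
  have step : ∀ (z : Ultrafilter (FreeMonoid B)) (x : FreeMonoid B), z ∈ L →
      (∀ᶠ y in z, g (x * y) = k) → ∀ᶠ y in z, x * y ∈ δ := by
    intro z x hz h
    have h2 : ∀ a, ∀ᶠ y in z, ∀ᶠ w in q, g (x * (y * σ a w)) = k := by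
      intro a
      rw [← hid z hz a] at h
      exact h
    filter_upwards [eventually_all.mpr h2] with y hy
    change ∀ᶠ w in q, ∀ a, g (x * y * σ a w) = k
    refine eventually_all.mpr fun a => ?_
    simpa only [mul_assoc] using hy a
  have hδ : ∀ᶠ x in e, x ∈ δ := by
    simpa using step e 1 he (by simpa using hk)
  refine ⟨k, {x | g x = k ∧ x ∈ δ}, (hk.and hδ).exists, fun x hx => hx.1, fun E hE hEP => ?_⟩
  have h3 : ∀ x ∈ E, ∀ᶠ w in q, ∀ a, g (FreeMonoid.ofList x * σ a w) = k ∧ FreeMonoid.ofList x * σ a w ∈ δ := by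
    intro x hx
    refine eventually_all.mpr fun a => ?_
    have h4 : ∀ᶠ w in q, ∀ a, g (FreeMonoid.ofList x * σ a w) = k := (hEP hx).2
    have h5 : ∀ᶠ y in q.map (σ a), g (FreeMonoid.ofList x * y) = k := h4.mono fun w hw => hw a
    exact h5.and (step _ (FreeMonoid.ofList x) (hσL a) h5)
  have h6 : ∀ᶠ w in q, w ∈ V := hVmul X ê hX
  obtain ⟨w, hwV, hw⟩ := (h6.and ((eventually_all_finite hE).mpr h3)).exists
  exact ⟨w, hwV, fun x hx a => hw x hx a⟩

end Colouring

section CarlsonSimpson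

variable {ι : Type} {A : ι → Type}

/-- Successive substitution of the letters of a word in a sequence of variable words. -/
def substSeq {B : Type} (w : ℕ → List (Option B)) : ℕ → List B → List B
  | _, [] => []
  | n, a :: x => subst a (w n) ++ substSeq w (n + 1) x

lemma substSeq_append {B : Type} (w : ℕ → List (Option B)) (n : ℕ) (x : List B) (a : B) :
    substSeq w n (x ++ [a]) = substSeq w n x ++ subst a (w (n + x.length)) := by
  induction x generalizing n with
  | nil => simp [substSeq]
  | cons b x ih =>
    simp [substSeq, ih, List.append_assoc]
    rw [show n + 1 + x.length = n + (x.length + 1) by ring]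

/-- The Carlson–Simpson theorem, in the form of a Halpern–Läuchli colouring theorem. -/
theorem exists_strong_monochromatic [Finite (∀ i, A i)] [Nonempty (∀ i, A i)]
    {κ : Type} [Finite κ] (c : List (∀ i, A i) → κ) :
    ∃ F, Strong F ∧ ∀ x y, c (F x) = c (F y) := by
  obtain ⟨k, P, ⟨u, hu⟩, hPk, hP⟩ := exists_recurrent_colour_class c
  choose! w hwV hw using hP
  let next : Set (List (∀ i, A i)) → Set (List (∀ i, A i)) :=
    fun E => ⋃ x ∈ E, Set.range fun a => x ++ subst a (w E)
  let E : ℕ → Set (List (∀ i, A i)) := fun n => next^[n] {u}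
  have hsucc : ∀ n, E (n + 1) = next (E n) := fun n => Function.iterate_succ_apply' _ _ _
  have hE : ∀ n, (E n).Finite ∧ E n ⊆ P := by
    intro n
    induction n with
    | zero => exact ⟨Set.finite_singleton u, by simpa [E] using hu⟩
    | succ n ih =>
      rw [hsucc]
      refine ⟨ih.1.biUnion fun x _ => Set.finite_range _, ?_⟩
      simp only [next, Set.iUnion_subset_iff]
      rintro x hx _ ⟨a, rfl⟩
      exact hw _ ih.1 ih.2 x hx a
  let v : ℕ → List (Option (∀ i, A i)) := fun n => w (E n)
  have hmem : ∀ x, u ++ substSeq v 0 x ∈ E x.length := by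
    intro x
    induction x using List.reverseRecOn with
    | nil => simp [substSeq, E]
    | append_singleton x a ih =>
      rw [substSeq_append, List.length_append, List.length_singleton, hsucc, ← List.append_assoc,
        zero_add]
      exact Set.mem_biUnion ih ⟨a, rfl⟩
  have hlen : ∀ x y n, x.length = y.length →
      (substSeq v n x).length = (substSeq v n y).length := by
    intro x
    induction x with
    | nil => intro y n h; rw [List.length_nil, eq_comm, List.length_eq_zero_iff] at h; rw [h]
    | cons a x ih =>
      intro y n h
      cases y with
      | nil => simp at h
      | cons b y => simp [substSeq, subst, ih y (n + 1) (by simpa using h)]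
  have hloc : ∀ i x y n, pr i x = pr i y → pr i (substSeq v n x) = pr i (substSeq v n y) := by
    intro i x
    induction x with
    | nil =>
      intro y n h
      have : y = [] := by simpa [pr] using h.symm
      rw [this]
    | cons a x ih =>
      intro y n h
      cases y with
      | nil => simp at h
      | cons b y =>
        rw [pr_cons, pr_cons] at h
        obtain ⟨h1, h2⟩ := List.cons.inj h
        rw [substSeq, substSeq, pr_append, pr_append, ih y (n + 1) h2]
        congr 1
        simp only [pr, subst, List.map_map]
        refine List.map_congr_left fun o _ => ?_
        cases o <;> simp [h1]
  refine ⟨fun x => u ++ substSeq v 0 x, ⟨fun x y h => ?_, fun x a => ?_, fun i x y h => ?_⟩,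
    fun x y => ?_⟩
  · simp [hlen x y 0 h]
  · obtain ⟨r, hr⟩ := hwV _ (hE (0 + x.length)).1 (hE _).2
    have : subst a (v (0 + x.length)) = a :: subst a r := by
      change subst a (w _) = _
      rw [hr]; rfl
    rw [substSeq_append, this]
    exact ⟨subst a r, by simp⟩
  · simp [hloc i x y 0 h]
  · rw [hPk _ ((hE _).2 (hmem x)), hPk _ ((hE _).2 (hmem y))]

end CarlsonSimpson

section Uniformization

variable {ι : Type} {A : ι → Type}

lemma eq_of_pr {x y : List (∀ i, A i)} (hl : x.length = y.length) (h : ∀ i, pr i x = pr i y) :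
    x = y := by
  refine List.ext_getElem hl fun n h1 h2 => funext fun i => ?_
  have := List.getElem_of_eq (h i) (by simpa using h1)
  simpa [pr] using this

lemma exists_word {m : ℕ} (y : ∀ i, List (A i)) (hy : ∀ i, (y i).length = m) :
    ∃ x : List (∀ i, A i), x.length = m ∧ ∀ i, pr i x = y i := by
  refine ⟨List.ofFn fun (t : Fin m) i => (y i)[t]'(by rw [hy i]; exact t.2), by simp,
    fun i => ?_⟩
  refine List.ext_getElem (by simp [hy i]) fun n h1 h2 => ?_
  simp [pr]

/-- The function on `Fin (n + 1)` given by a word of length at least `n + 1`. -/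
def wordFn (n : ℕ) {B : Type} (b : B) (u : List B) : Fin (n + 1) → B := fun j => u.getD j b

/-- Evaluation of a word in an alphabet indexed by the nodes of length `n + 1` at such a node. -/
def evalAt (n : ℕ) (a₀ : ∀ i, A i) (x : List (∀ i, A i))
    (z : List (∀ k : (i : ι) × (Fin (n + 1) → A i), A k.1)) : List (∀ i, A i) :=
  z.map fun α i => α ⟨i, wordFn n (a₀ i) (pr i x)⟩

lemma pr_evalAt (n : ℕ) (a₀ : ∀ i, A i) (x : List (∀ i, A i))
    (z : List (∀ k : (i : ι) × (Fin (n + 1) → A i), A k.1)) (i : ι) :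
    pr i (evalAt n a₀ x z) = pr ⟨i, wordFn n (a₀ i) (pr i x)⟩ z := by
  simp [pr, evalAt]

lemma exists_strong_fixing [Finite ι] [∀ i, Finite (A i)] [∀ i, Nonempty (A i)] (n : ℕ)
    {κ : List (∀ i, A i) → Type} [∀ x, Finite (κ x)]
    (c : ∀ x : List (∀ i, A i), ((∀ i, A i) → List (∀ i, A i)) → κ x) :
    ∃ h, Strong h ∧ (∀ x, x.length ≤ n → h x = x) ∧ ∀ x, x.length = n → ∀ φ ψ,
      IsFan x φ → IsFan x ψ → c (h x) (fun p => h (φ p)) = c (h x) (fun p => h (ψ p)) := by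
  classical
  let K := (i : ι) × (Fin (n + 1) → A i)
  obtain ⟨a₀⟩ : Nonempty (∀ i, A i) := inferInstance
  have hfin : Finite {x : List (∀ i, A i) // x.length = n} :=
    (List.finite_length_eq (∀ i, A i) n).to_subtype
  obtain ⟨f, hf, hfc⟩ := exists_strong_monochromatic (A := fun k : K => A k.1)
    (fun z (x : {x : List (∀ i, A i) // x.length = n}) =>
      c x.1 (fun p => (x.1 ++ [p]) ++ evalAt n a₀ (x.1 ++ [p]) z))
  let dg : List (∀ i, A i) → List (∀ k : K, A k.1) := fun s => s.map fun a k => a k.1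
  have hdg : ∀ (k : K) s, pr k (dg s) = pr k.1 s := fun k s => by simp [pr, dg]
  let h : List (∀ i, A i) → List (∀ i, A i) := fun v =>
    if v.length ≤ n then v else
      v.take (n + 1) ++ evalAt n a₀ (v.take (n + 1)) (f (dg (v.drop (n + 1))))
  have hshort : ∀ v, v.length ≤ n → h v = v := fun v hv => if_pos hv
  have hlong : ∀ v, ¬ v.length ≤ n → h v =
    v.take (n + 1) ++ evalAt n a₀ (v.take (n + 1)) (f (dg (v.drop (n + 1)))) :=
      fun v hv => if_neg hv
  have hcons : ∀ x p s, x.length = n →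
      h (x ++ [p] ++ s) = (x ++ [p]) ++ evalAt n a₀ (x ++ [p]) (f (dg s)) := by
    intro x p s hx
    have hx' : (x ++ [p]).length = n + 1 := by simp [hx]
    rw [hlong _ (by simp [hx]), List.take_left' hx', List.drop_left' hx']
  refine ⟨h, ⟨fun x y hxy => ?_, fun x a => ?_, fun i x y hxy => ?_⟩, hshort,
    fun x hx φ ψ hφ hψ => ?_⟩
  · by_cases hx : x.length ≤ n
    · rw [hshort x hx, hshort y (hxy ▸ hx), hxy]
    · rw [hlong x hx, hlong y (hxy ▸ hx)]
      have := hf.len (dg (x.drop (n + 1))) (dg (y.drop (n + 1))) (by simp [dg, hxy])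
      simp [evalAt, this, hxy]
  · rcases lt_trichotomy x.length n with hx | hx | hx
    · rw [hshort x hx.le, hshort _ (by simp; omega)]
    · have := hcons x a [] hx
      rw [List.append_nil] at this
      rw [this, hshort x hx.le]
      exact List.prefix_append _ _
    · rw [hlong x (by omega), hlong (x ++ [a]) (by simp; omega),
        List.take_append_of_le_length (by omega), List.drop_append_of_le_length (by omega),
        List.append_assoc, List.prefix_append_right_inj]
      have h1 : dg (x.drop (n + 1) ++ [a]) = dg (x.drop (n + 1)) ++ [fun k : K => a k.1] := by
        simp [dg]
      have h2 := (hf.ext (dg (x.drop (n + 1))) (fun k : K => a k.1)).map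
        (fun α i => α ⟨i, wordFn n (a₀ i) (pr i (x.take (n + 1)))⟩)
      rw [h1]
      rw [List.map_append] at h2
      exact h2
  · have hl : x.length = y.length := by simpa using congrArg List.length hxy
    by_cases hx : x.length ≤ n
    · rw [hshort x hx, hshort y (hl ▸ hx), hxy]
    · rw [hlong x hx, hlong y (hl ▸ hx), pr_append, pr_append, pr_evalAt, pr_evalAt, pr_take,
        pr_take, hxy]
      congr 1
      apply hf.loc
      rw [hdg, hdg, pr_drop, pr_drop, hxy]
  · have key : ∀ φ, IsFan x φ → ∃ z, (fun p => h (φ p)) =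
        fun p => (x ++ [p]) ++ evalAt n a₀ (x ++ [p]) (f z) := by
      intro φ hφ
      choose s hs using hφ.ext
      have hslen : ∀ p, (s p).length = (s a₀).length := by
        intro p
        have := hφ.len p a₀
        rw [← hs, ← hs] at this
        simpa using this
      have hsloc : ∀ i p q, p i = q i → pr i (s p) = pr i (s q) := by
        intro i p q hpq
        have := hφ.loc i p q hpq
        rw [← hs, ← hs] at this
        simpa [hpq] using this
      have hinj : ∀ i (p q : ∀ i, A i), wordFn n (a₀ i) (pr i (x ++ [p])) =
          wordFn n (a₀ i) (pr i (x ++ [q])) → p i = q i := by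
        intro i p q hpq
        have := congrFun hpq (Fin.last n)
        simpa [wordFn, pr, List.getD_eq_getElem?_getD, ← hx] using this
      obtain ⟨z, hz, hzp⟩ := exists_word (A := fun k : K => A k.1) (m := (s a₀).length)
        (fun k => if hk : ∃ p, wordFn n (a₀ k.1) (pr k.1 (x ++ [p])) = k.2 then
          pr k.1 (s hk.choose) else pr k.1 (s a₀)) (fun k => by
            split_ifs <;> simp [hslen])
      refine ⟨z, funext fun p => ?_⟩
      rw [← hs p, hcons x p (s p) hx]
      congr 1
      refine eq_of_pr ?_ fun i => ?_
      · simp only [evalAt, List.length_map]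
        apply hf.len
        rw [hz, ← hslen p]
        simp [dg]
      · rw [pr_evalAt, pr_evalAt]
        apply hf.loc
        have hk : ∃ q, wordFn n (a₀ i) (pr i (x ++ [q])) =
            wordFn n (a₀ i) (pr i (x ++ [p])) := ⟨p, rfl⟩
        rw [hdg, hzp, dif_pos hk]
        exact hsloc i _ _ (hinj i _ _ hk.choose_spec).symm
    obtain ⟨z, hz⟩ := key φ hφ
    obtain ⟨z', hz'⟩ := key ψ hψ
    rw [hz, hz', hshort x hx.le]
    exact congrFun (hfc z z') ⟨x, hx⟩

/-- Given finite colourings of the fans over each node, there is a strong subtree such that the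
colour of a fan with root at one of the first `N` levels only depends on the root. -/
theorem exists_strong_fan_uniform [Finite ι] [∀ i, Finite (A i)] [∀ i, Nonempty (A i)] (N : ℕ)
    {κ : List (∀ i, A i) → Type} [∀ x, Finite (κ x)]
    (c : ∀ x : List (∀ i, A i), ((∀ i, A i) → List (∀ i, A i)) → κ x) :
    ∃ g, Strong g ∧ ∀ x, x.length < N → ∀ φ ψ,
      IsFan x φ → IsFan x ψ → c (g x) (fun p => g (φ p)) = c (g x) (fun p => g (ψ p)) := by
  induction N with
  | zero => exact ⟨_, Strong.id, fun x hx => absurd hx (by simp)⟩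
  | succ N ih =>
    obtain ⟨g, hg, hgc⟩ := ih
    obtain ⟨h, hh, hfix, hhc⟩ := exists_strong_fixing N (κ := fun x => κ (g x))
      (fun x φ => c (g x) (fun p => g (φ p)))
    refine ⟨_, hg.comp hh, fun x hx φ ψ hφ hψ => ?_⟩
    rcases Nat.lt_succ_iff_lt_or_eq.mp hx with hx | hx
    · exact hgc (h x) (by rwa [hfix x hx.le]) _ _ (hh.fan_map hφ) (hh.fan_map hψ)
    · exact hhc x hx φ ψ hφ hψ

end Uniformization

section Fans

variable {ι : Type} {A : ι → Type}

/-- The infinite density Halpern–Läuchli property of the trees of words over the alphabets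
`A i`. -/
def DensityHL (A : ι → Type) [Fintype (∀ i, A i)] : Prop :=
  ∀ (D : Set (List (∀ i, A i))) (ε : ℝ), 0 < ε →
    (∃ᶠ m in atTop, ε ≤ mean m (fun x => ind (x ∈ D))) → ∃ F, Strong F ∧ ∀ x, F x ∈ D

lemma mean_finset_sum_sub_const {B : Type} [Fintype B] [Nonempty B] {κ : Type} (j : ℕ)
    (t : Finset κ) (φ : κ → List B → ℝ) (c : ℝ) :
    mean j (fun v => ∑ m ∈ t, (φ m v - c)) = ∑ m ∈ t, (mean j (φ m) - c) := by
  rw [mean_sum]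
  exact Finset.sum_congr rfl fun m _ => by rw [mean_sub, mean_const]

/-- A set which is dense on average has a node above which all initial averages are large. -/
lemma exists_dense_translate {B : Type} [Fintype B] [Nonempty B] (D : Set (List B)) (N : ℕ)
    (δ : ℝ) (hδ : 0 ≤ δ) :
    ∃ u : List B, u.length ≤ N ∧
      ∑ m ∈ Finset.range N, (mean m (fun x => ind (x ∈ D)) - δ) ≤ ((N - u.length : ℕ) : ℝ) ∧
      ∀ j ≤ N - u.length, δ * j ≤ ∑ m ∈ Finset.range j, mean m (fun x => ind (u ++ x ∈ D)) := by
  let Ψ : List B → ℝ := fun u =>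
    ∑ m ∈ Finset.range (N - u.length), (mean m (fun x => ind (u ++ x ∈ D)) - δ)
  obtain ⟨u, hu, humax⟩ := Set.exists_max_image {u : List B | u.length < N + 1} Ψ
    (List.finite_length_lt B (N + 1)) ⟨[], by simp⟩
  have hu' : u.length < N + 1 := hu
  refine ⟨u, by omega, ?_, fun j hj => ?_⟩
  · have h1 : Ψ [] ≤ Ψ u := humax [] (by simp)
    have h2 : Ψ u ≤ ∑ m ∈ Finset.range (N - u.length), (1 : ℝ) :=
      Finset.sum_le_sum fun m _ => by linarith [mean_ind_le_one m fun x => u ++ x ∈ D]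
    simp only [Finset.sum_const, Finset.card_range, nsmul_eq_mul, mul_one] at h2
    exact h1.trans h2
  · have h1 : Ψ u = ∑ m ∈ Finset.range j, (mean m (fun x => ind (u ++ x ∈ D)) - δ) +
        mean j (fun v => Ψ (u ++ v)) := by
      have h2 : mean j (fun v => Ψ (u ++ v)) = ∑ m ∈ Finset.range (N - u.length - j),
          (mean (j + m) (fun x => ind (u ++ x ∈ D)) - δ) := by
        rw [mean_congr j (ψ := fun v => ∑ m ∈ Finset.range (N - u.length - j),
          (mean m (fun x => ind (u ++ (v ++ x) ∈ D)) - δ))]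
        · rw [mean_finset_sum_sub_const]
          simp only [mean_append]
        · intro v hv
          simp only [Ψ, List.length_append, hv, List.append_assoc, Nat.sub_add_eq]
      rw [h2, ← Finset.sum_range_add, Nat.add_sub_cancel' hj]
    have h3 : mean j (fun v => Ψ (u ++ v)) ≤ Ψ u := by
      refine mean_le_of_le j fun v hv => humax _ ?_
      simp only [Set.mem_ofPred_eq, List.length_append]
      omega
    have h4 : 0 ≤ ∑ m ∈ Finset.range j, (mean m (fun x => ind (u ++ x ∈ D)) - δ) := by linarith
    rw [Finset.sum_sub_distrib] at h4
    simp only [Finset.sum_const, Finset.card_range, nsmul_eq_mul] at h4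
    linarith

lemma frequently_of_sum_ge {a : ℕ → ℝ} {δ : ℝ} (hδ : 0 < δ) (h1 : ∀ m, a m ≤ 1)
    (h : ∀ j : ℕ, δ * j ≤ ∑ m ∈ Finset.range j, a m) : ∃ᶠ m in atTop, δ / 2 ≤ a m := by
  by_contra hcon
  rw [not_frequently, eventually_atTop] at hcon
  obtain ⟨M, hM⟩ := hcon
  obtain ⟨j, hj⟩ := exists_nat_gt (2 * M / δ)
  have h2 : ∀ m ∈ Finset.range j, a m ≤ δ / 2 + if m < M then 1 else 0 := by
    intro m _
    split_ifs with hm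
    · linarith [h1 m]
    · linarith [not_le.mp (hM m (not_lt.mp hm))]
  have h3 := (h j).trans (Finset.sum_le_sum h2)
  rw [Finset.sum_add_distrib, ← Finset.sum_filter] at h3
  simp only [Finset.sum_const, Finset.card_range, nsmul_eq_mul, mul_one] at h3
  have h4 : (({m ∈ Finset.range j | m < M}.card : ℕ) : ℝ) ≤ M := by
    have : ({m ∈ Finset.range j | m < M}).card ≤ (Finset.range M).card :=
      Finset.card_le_card fun m hm => by simp at hm ⊢; exact hm.2
    simpa using this
  rw [div_lt_iff₀ hδ] at hj
  linarith

lemma ultrafilter_eventually_iff {α : Type} (U : Ultrafilter α) (p : α → Prop) :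
    ∀ᶠ a in U, ((∀ᶠ b in U, p b) ↔ p a) := by
  by_cases h : ∀ᶠ b in U, p b
  · exact h.mono fun a ha => iff_of_true h ha
  · exact (Ultrafilter.eventually_not.mpr h).mono fun a ha => iff_of_false h ha

variable [Fintype (∀ i, A i)] [Nonempty (∀ i, A i)]

/-- The finite form, for fans, of the density property. -/
lemma DensityHL.exists_fan (hA : DensityHL A) {ε : ℝ} (hε : 0 < ε) :
    ∃ N : ℕ, 1 ≤ N ∧ ∀ D : Set (List (∀ i, A i)),
      ε * N ≤ ∑ m ∈ Finset.range N, mean m (fun x => ind (x ∈ D)) →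
      ∃ x φ, IsFan x φ ∧ x ∈ D ∧ (∀ p, φ p ∈ D) ∧ ∀ p, (φ p).length < N := by
  by_contra! hcon
  choose! D hD hbad using hcon
  choose u hu hsum hδ using fun N => exists_dense_translate (D N) N (ε / 2) (by positivity)
  let U := hyperfilter ℕ
  have hlarge : ∀ j : ℕ, ∀ᶠ N in U, 1 ≤ N ∧ j ≤ N - (u N).length := by
    intro j
    obtain ⟨M, hM⟩ := exists_nat_gt (j / (ε / 2))
    have h1 : ∀ᶠ N in atTop, max 1 M ≤ N := eventually_ge_atTop _
    rw [← Nat.cofinite_eq_atTop] at h1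
    filter_upwards [hyperfilter_le_cofinite h1] with N hN
    refine ⟨(le_max_left _ _).trans hN, ?_⟩
    have h2 := hsum N
    rw [Finset.sum_sub_distrib] at h2
    simp only [Finset.sum_const, Finset.card_range, nsmul_eq_mul] at h2
    have h3 := hD N ((le_max_left _ _).trans hN)
    rw [div_lt_iff₀ (by positivity)] at hM
    have h4 : (M : ℝ) ≤ N := by exact_mod_cast (le_max_right _ _).trans hN
    have h5 : (M : ℝ) * (ε / 2) ≤ N * (ε / 2) := by gcongr
    have : (j : ℝ) ≤ ((N - (u N).length : ℕ) : ℝ) := by linarith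
    exact_mod_cast this
  let E : Set (List (∀ i, A i)) := {x | ∀ᶠ N in U, u N ++ x ∈ D N}
  have hE : ∀ j : ℕ, ε / 2 * j ≤ ∑ m ∈ Finset.range j, mean m (fun x => ind (x ∈ E)) := by
    intro j
    have h1 : ∀ᶠ N in U, ∀ x ∈ {x : List (∀ i, A i) | x.length < j},
        (x ∈ E ↔ u N ++ x ∈ D N) :=
      (eventually_all_finite (List.finite_length_lt _ j)).mpr fun x _ =>
        ultrafilter_eventually_iff U _
    obtain ⟨N, hN, hN2⟩ := (h1.and (hlarge j)).exists
    refine (hδ N j hN2.2).trans (Finset.sum_le_sum fun m hm => ?_)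
    refine mean_mono m fun x hx => ind_mono (hN x ?_).mpr
    simpa [hx] using hm
  obtain ⟨F, hF, hFE⟩ := hA E (ε / 2 / 2) (by positivity)
    (frequently_of_sum_ge (by positivity) (fun m => mean_ind_le_one m _) hE)
  obtain ⟨a⟩ := ‹Nonempty (∀ i, A i)›
  have h1 : ∀ᶠ N in U, ∀ p, u N ++ F [p] ∈ D N := eventually_all.mpr fun p => hFE [p]
  have h2 : ∀ᶠ N in U, u N ++ F [] ∈ D N := hFE []
  obtain ⟨N, hN1, hN2, hN3, hN4⟩ := (h1.and (h2.and (hlarge ((F [a]).length + 1)))).exists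
  obtain ⟨p, hp⟩ := hbad N hN3 (u N ++ F []) (fun p => u N ++ F [p])
    (((Strong.translate (u N)).comp hF).fan_map (isFan_cons [] [])) hN2 hN1
  have := hF.len [p] [a] rfl
  have := hu N
  simp only [List.length_append] at hp
  omega

/-- If the sets `C x` have measure at least `ε`, then for some fan of bounded height the
intersection of its sets has measure at least `θ`. -/
lemma DensityHL.exists_fan_mean (hA : DensityHL A) {ε : ℝ} (hε : 0 < ε) :
    ∃ (N : ℕ) (θ : ℝ), 0 < θ ∧ ∀ (B : Type) [Fintype B] [Nonempty B] (M : ℕ)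
      (C : List (∀ i, A i) → Set (List B)),
      (∀ x, x.length < N → ε ≤ mean M (fun y => ind (y ∈ C x))) →
      ∃ x φ, IsFan x φ ∧ (∀ p, (φ p).length < N) ∧
        θ ≤ mean M (fun y => ind (y ∈ C x ∧ ∀ p, y ∈ C (φ p))) := by
  obtain ⟨N, hN, hfan⟩ := hA.exists_fan (ε := ε / 2) (by positivity)
  have hN0 : (0 : ℝ) < N := by exact_mod_cast hN
  have hfin : {f : List (∀ i, A i) × ((∀ i, A i) → List (∀ i, A i)) |
      IsFan f.1 f.2 ∧ ∀ p, (f.2 p).length < N}.Finite := by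
    refine ((List.finite_length_lt (∀ i, A i) N).prod
      (Set.Finite.pi' fun _ : (∀ i, A i) => List.finite_length_lt (∀ i, A i) N)).subset ?_
    rintro ⟨x, φ⟩ ⟨h1, h2⟩
    refine ⟨?_, h2⟩
    obtain ⟨a⟩ := ‹Nonempty (∀ i, A i)›
    have := (h1.ext a).length_le
    have := h2 a
    simp only [Set.mem_ofPred_eq, List.length_append] at *
    omega
  refine ⟨N, ε / 2 / (hfin.toFinset.card + 1), by positivity, fun B _ _ M C hC => ?_⟩
  by_contra! hcon
  let rich : List B → Prop := fun y =>
    ε / 2 * N ≤ ∑ m ∈ Finset.range N, mean m (fun x => ind (x ∈ {x | y ∈ C x}))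
  have hrich : ε / 2 ≤ mean M (fun y => ind (rich y)) := by
    have h1 : ε * N ≤ ∑ m ∈ Finset.range N, mean M (fun y => mean m (fun x => ind (y ∈ C x))) := by
      rw [mul_comm, ← nsmul_eq_mul, ← Finset.card_range N, ← Finset.sum_const, Finset.card_range]
      refine Finset.sum_le_sum fun m hm => ?_
      rw [mean_comm]
      rw [← mean_const (B := ∀ i, A i) m ε]
      exact mean_mono m fun x hx => hC x (by simpa [hx] using hm)
    rw [← mean_sum] at h1
    have h2 : mean M (fun y => ∑ m ∈ Finset.range N, mean m (fun x => ind (y ∈ C x)) - ε / 2 * N)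
        ≤ mean M (fun y => N * ind (rich y)) := by
      refine mean_mono M fun y _ => ?_
      by_cases hy : rich y
      · have h3 : ∑ m ∈ Finset.range N, mean m (fun x => ind (y ∈ C x)) ≤
            ∑ m ∈ Finset.range N, (1 : ℝ) :=
          Finset.sum_le_sum fun m _ => mean_ind_le_one m _
        simp only [Finset.sum_const, Finset.card_range, nsmul_eq_mul, mul_one] at h3
        rw [ind_true hy]
        nlinarith
      · rw [ind_false hy]
        have := not_le.mp hy
        simp only [Set.mem_ofPred_eq] at this
        linarith
    rw [mean_sub, mean_const, mean_const_mul] at h2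
    refine le_of_mul_le_mul_left ?_ hN0
    linarith
  have h1 : mean M (fun y => ind (rich y)) ≤ mean M (fun y => ∑ f ∈ hfin.toFinset,
      ind (y ∈ C f.1 ∧ ∀ p, y ∈ C (f.2 p))) := by
    refine mean_mono M fun y _ => ?_
    by_cases hy : rich y
    · obtain ⟨x, φ, hf, hx, hp, hl⟩ := hfan _ hy
      rw [ind_true hy, ← ind_true (p := y ∈ C x ∧ ∀ p, y ∈ C (φ p)) ⟨hx, hp⟩]
      exact Finset.single_le_sum
        (f := fun f => ind (y ∈ C f.1 ∧ ∀ p, y ∈ C (f.2 p))) (fun f _ => ind_nonneg _)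
        (hfin.mem_toFinset.mpr ⟨hf, hl⟩ : (x, φ) ∈ hfin.toFinset)
    · rw [ind_false hy]
      exact Finset.sum_nonneg fun f _ => ind_nonneg _
  rw [mean_sum] at h1
  have h2 : ∑ f ∈ hfin.toFinset, mean M (fun y => ind (y ∈ C f.1 ∧ ∀ p, y ∈ C (f.2 p))) ≤
      ∑ f ∈ hfin.toFinset, ε / 2 / (hfin.toFinset.card + 1) :=
    Finset.sum_le_sum fun f hf => by
      obtain ⟨h3, h4⟩ := hfin.mem_toFinset.mp hf
      exact (hcon f.1 f.2 h3 h4).le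
  rw [Finset.sum_const, nsmul_eq_mul] at h2
  have h3 : (hfin.toFinset.card : ℝ) * (ε / 2 / (hfin.toFinset.card + 1)) < ε / 2 := by
    rw [mul_div_assoc', div_lt_iff₀ (by positivity)]
    linarith
  linarith

end Fans

section Step

lemma ind_forall {J : Type} [Fintype J] (p : J → Prop) : ind (∀ j, p j) = ∏ j, ind (p j) := by
  by_cases h : ∀ j, p j
  · rw [ind_true h, Finset.prod_congr rfl fun j _ => ind_true (h j), Finset.prod_const_one]
  · obtain ⟨j, hj⟩ := not_forall.mp h
    rw [ind_false h, Finset.prod_eq_zero (Finset.mem_univ j) (ind_false hj)]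

lemma mean_pr {J : Type} [Fintype J] {B : Type} [Fintype B] [Nonempty B] [Fintype (J → B)]
    (m : ℕ) (j : J) (φ : List B → ℝ) :
    mean m (fun y : List (J → B) => φ (pr (A := fun _ => B) j y)) = mean m φ := by
  classical
  have h := mean_prod (J := J) m (fun k s => if k = j then φ s else (1 : ℝ))
  have h1 : ∀ k, mean m (fun s : List B => if k = j then φ s else 1) =
      if k = j then mean m φ else 1 := by
    intro k
    split_ifs with hk
    · rfl
    · exact mean_const m 1
  simp only [h1, Finset.prod_ite_eq', Finset.mem_univ, if_true] at h
  rw [← h]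
  congr!

lemma inv_card_le_mean {B : Type} [Fintype B] [Nonempty B] (m : ℕ) {p : List B → Prop} (a : B)
    (h : ∀ s, s.length = m → p (a :: s)) :
    (Fintype.card B : ℝ)⁻¹ ≤ mean (m + 1) (fun s => ind (p s)) := by
  rw [mean, inv_eq_one_div]
  gcongr
  rw [← mean_const (B := B) m 1]
  refine (mean_mono m fun s hs => (ind_true (h s hs)).ge).trans ?_
  exact Finset.single_le_sum (f := fun a => mean m (fun s => ind (p (a :: s))))
    (fun a _ => mean_nonneg m fun s => ind_nonneg _) (Finset.mem_univ a)

variable {ι : Type} {A : ι → Type}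

/-- A dense level selection `D` on the level product of the `A i`, with values in the tree of
words over `B`, all of whose values are `ε`-dense above every node in `J`. -/
structure DenseAbove {B : Type} [Fintype B] (D : List (∀ i, A i) → Set (List B)) (l : ℕ → ℕ)
    (J : Finset (List B)) (lam : ℕ) (ε : ℝ) : Prop where
  strictMono : StrictMono l
  le : lam ≤ l 0
  length_eq : ∀ j ∈ J, j.length = lam
  pos : 0 < ε
  dense : ∀ x, ∀ j ∈ J, ε ≤ mean (l x.length - lam) (fun s => ind (j ++ s ∈ D x))

variable [Finite ι] [∀ i, Finite (A i)] [∀ i, Nonempty (A i)] {B : Type} [Fintype B]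

/-- The intersection of the values of `D` along the fan `g ∘ φ` has density at least `θ`
above `v`. -/
def FanDense (D : List (∀ i, A i) → Set (List B)) (l : ℕ → ℕ) (θ : ℝ) (a : ∀ i, A i)
    (x : List (∀ i, A i)) (φ : (∀ i, A i) → List (∀ i, A i)) (v : List B) : Prop :=
  θ ≤ mean (l (φ a).length - (l x.length + 1)) (fun s => ind (∀ p, v ++ s ∈ D (φ p)))

lemma exists_strong_fanDense_uniform (D : List (∀ i, A i) → Set (List B)) (l : ℕ → ℕ) (θ : ℝ)
    (a : ∀ i, A i) (N : ℕ) :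
    ∃ g, Strong g ∧ ∀ x, x.length < N → ∀ φ ψ, IsFan x φ → IsFan x ψ → ∀ v : List B,
      v.length = l (g x).length + 1 → FanDense D l θ a (g x) (fun p => g (φ p)) v →
        FanDense D l θ a (g x) (fun p => g (ψ p)) v := by
  have hfin : ∀ x : List (∀ i, A i), Finite {v : List B // v.length = l x.length + 1} :=
    fun x => (List.finite_length_eq B _).to_subtype
  obtain ⟨g, hg, hgc⟩ := exists_strong_fan_uniform (A := A) N
    (κ := fun x => Set {v : List B // v.length = l x.length + 1})
    (fun x φ => {v | FanDense D l θ a x φ v.1})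
  refine ⟨g, hg, fun x hx φ ψ hφ hψ v hv h => ?_⟩
  exact ((Set.ext_iff.mp (hgc x hx φ ψ hφ hψ)) ⟨v, hv⟩).mp h

variable [Fintype (∀ i, A i)] [Nonempty B]

lemma DenseAbove.exists_step_node (hA : DensityHL A) {D : List (∀ i, A i) → Set (List B)}
    {l : ℕ → ℕ} {J : Finset (List B)} {lam : ℕ} {ε : ℝ} (hD : DenseAbove D l J lam ε)
    (a : ∀ i, A i) :
    ∃ (θ : ℝ) (g : List (∀ i, A i) → List (∀ i, A i)) (x : List (∀ i, A i)) (w : List B → List B),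
      0 < θ ∧ Strong g ∧ ∀ j ∈ J, (j <+: w j ∧ (w j).length = l (g x).length ∧ w j ∈ D (g x)) ∧
        ∀ q φ, IsFan x φ → FanDense D l θ a (g x) (fun p => g (φ p)) (w j ++ [q]) := by
  classical
  have hb : (0 : ℝ) < Fintype.card (J → B) := by exact_mod_cast Fintype.card_pos
  have hε := hD.pos
  obtain ⟨N, θ, hθ, hR⟩ := hA.exists_fan_mean
    (ε := (Fintype.card (J → B) : ℝ)⁻¹ * ε ^ Fintype.card J) (by positivity)
  obtain ⟨g, hg, hgu⟩ := exists_strong_fanDense_uniform D l (θ / 2) a N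
  obtain ⟨H, hH, hgH⟩ := hg.exists_levels
  refine ⟨θ / 2, g, ?_⟩
  by_contra! hcon
  have hbad : ∀ x, x.length < N → ∀ w : List B → List B,
      (∀ j ∈ J, j <+: w j ∧ (w j).length = l (H x.length) ∧ w j ∈ D (g x)) →
      ∃ j ∈ J, ∃ q, ∀ φ, IsFan x φ →
        ¬ FanDense D l (θ / 2) a (g x) (fun p => g (φ p)) (w j ++ [q]) := by
    intro x hx w hw
    simp only [← hgH] at hw
    obtain ⟨j, hj, h1⟩ := hcon x w (by positivity) hg
    obtain ⟨q, ψ, hψ, h2⟩ := h1 (hw j hj)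
    exact ⟨j, hj, q, fun φ hφ h => h2 (hgu x hx φ ψ hφ hψ _ (by simp [(hw j hj).2.1]) h)⟩
  have hlam : ∀ n, lam ≤ l n := fun n => hD.le.trans (hD.strictMono.monotone (Nat.zero_le n))
  have hlH : StrictMono fun n => l (H n) := hD.strictMono.comp hH
  let Bad : List (∀ i, A i) → List B → Prop := fun x v =>
    ∀ φ, IsFan x φ → ¬ FanDense D l (θ / 2) a (g x) (fun p => g (φ p)) v
  let C : List (∀ i, A i) → Set (List (J → B)) := fun x =>
    {y | (∀ j : J, j.1 ++ pr (A := fun _ => B) j (y.take (l (H x.length) - lam)) ∈ D (g x)) ∧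
      ∃ j : J, Bad x (j.1 ++ pr (A := fun _ => B) j (y.take (l (H x.length) - lam + 1)))}
  obtain ⟨x, φ, hfan, hφN, hmean⟩ := hR (J → B) (l (H N) - lam) C (by
    intro x hx
    have hlt : l (H x.length) < l (H N) := hlH hx
    obtain ⟨r, hr⟩ : ∃ r, l (H N) - lam = (l (H x.length) - lam) + (r + 1) :=
      ⟨l (H N) - l (H x.length) - 1, by have := hlam (H x.length); omega⟩
    rw [hr, mean_append]
    have h1 : ε ^ Fintype.card J ≤ mean (l (H x.length) - lam) (fun u : List (J → B) =>
        ind (∀ j : J, j.1 ++ pr (A := fun _ => B) j u ∈ D (g x))) := by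
      simp only [ind_forall]
      have h2 := mean_prod (J := J) (B := B) (l (H x.length) - lam)
        (fun j s => ind (j.1 ++ s ∈ D (g x)))
      refine le_trans ?_ h2.ge
      rw [Fintype.card, ← Finset.prod_const]
      refine Finset.prod_le_prod (fun _ _ => hε.le) fun j _ => ?_
      have := hD.dense (g x) j.1 j.2
      rwa [hgH] at this
    have h3 : (Fintype.card (J → B) : ℝ)⁻¹ * ε ^ Fintype.card J ≤ _ :=
      mul_le_mul_of_nonneg_left h1 (by positivity)
    refine h3.trans ?_
    rw [← mean_const_mul]
    refine mean_mono _ fun u hu => ?_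
    by_cases hall : ∀ j : J, j.1 ++ pr (A := fun _ => B) j u ∈ D (g x)
    · rw [ind_true hall, mul_one]
      obtain ⟨j, hj, q, hq⟩ := hbad x hx
        (fun j => if h : j ∈ J then j ++ pr (A := fun _ => B) (⟨j, h⟩ : J) u else j) (by
          intro j hj
          simp only [dif_pos hj]
          refine ⟨List.prefix_append _ _, ?_, hall ⟨j, hj⟩⟩
          have := hlam (H x.length)
          simp [hD.length_eq j hj, hu]
          omega)
      refine inv_card_le_mean r (fun _ => q) fun s _ => ?_
      refine ⟨fun k => ?_, ⟨j, hj⟩, ?_⟩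
      · rw [List.take_left' hu]
        exact hall k
      · rw [List.append_cons, List.take_left' (by simp [hu])]
        simp only [dif_pos hj] at hq
        simpa using hq
    · rw [ind_false hall, mul_zero]
      exact mean_nonneg _ fun s => ind_nonneg _)
  refine absurd hmean (not_le.mpr (lt_of_le_of_lt ?_ (half_lt_self hθ)))
  have hxφ : x.length < (φ a).length := by
    have := (hfan.ext a).length_le
    simpa using this
  have hl1 : l (H x.length) < l (H (φ a).length) := hlH hxφ
  have hl2 : l (H (φ a).length) < l (H N) := hlH (hφN a)
  have hl0 := hlam (H x.length)
  obtain ⟨r, hr⟩ : ∃ r, l (H N) - lam = (l (H x.length) - lam + 1) +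
      ((l (H (φ a).length) - (l (H x.length) + 1)) + r) :=
    ⟨l (H N) - l (H (φ a).length), by omega⟩
  rw [hr, mean_append]
  refine mean_le_of_le _ fun v hv => ?_
  rw [mean_append]
  by_cases hj : ∃ j : J, Bad x (j.1 ++ pr (A := fun _ => B) j v)
  · obtain ⟨j, hj⟩ := hj
    have h1 := not_le.mp (hj φ hfan)
    rw [hgH, hgH, ← mean_pr _ j] at h1
    refine le_trans (mean_mono _ fun s hs => mean_le_of_le r fun t _ => ind_mono ?_) h1.le
    rintro ⟨-, h2⟩ p
    have h3 := (h2 p).1 j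
    rw [hfan.len p a, ← List.append_assoc, List.take_left' (by simp [hv, hs]; omega)] at h3
    simpa using h3
  · refine (mean_le_of_le _ fun s _ => mean_le_of_le r fun t _ => ?_).trans (by positivity)
    rw [ind_false]
    rintro ⟨⟨-, j, hj'⟩, -⟩
    rw [List.take_left' hv] at hj'
    exact hj ⟨j, hj'⟩

/-- One step of the construction: a node `w j` is chosen above each `j ∈ J`, and the selection is
thinned out so that it is dense above all immediate successors of the chosen nodes. -/
lemma DenseAbove.exists_step (hA : DensityHL A) {D : List (∀ i, A i) → Set (List B)}
    {l : ℕ → ℕ} {J : Finset (List B)} {lam : ℕ} {ε : ℝ} (hD : DenseAbove D l J lam ε) :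
    ∃ (g : List (∀ i, A i) → List (∀ i, A i)) (h : ℕ → ℕ) (w : List B → List B)
      (J' : Finset (List B)) (θ : ℝ), Strong g ∧ (∀ x, (g x).length = h x.length) ∧
      (∀ j ∈ J, j <+: w j ∧ (w j).length = l (h 0) ∧ w j ∈ D (g []) ∧ ∀ q, w j ++ [q] ∈ J') ∧
      DenseAbove (fun r => {v | ∀ p, v ∈ D (g (p :: r))}) (fun m => l (h (m + 1))) J'
        (l (h 0) + 1) θ := by
  classical
  obtain ⟨a⟩ : Nonempty (∀ i, A i) := inferInstance
  obtain ⟨θ, g, x, w, hθ, hg, hw⟩ := hD.exists_step_node hA a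
  obtain ⟨H, hH, hgH⟩ := hg.exists_levels
  refine ⟨fun r => g (x ++ r), fun m => H (x.length + m), w,
    (J ×ˢ Finset.univ).image fun jq => w jq.1 ++ [jq.2], θ, hg.comp (Strong.translate x),
    fun r => by rw [hgH, List.length_append], fun j hj => ?_, ⟨?_, ?_, ?_, hθ, ?_⟩⟩
  · obtain ⟨⟨h1, h2, h3⟩, -⟩ := hw j hj
    refine ⟨h1, by rw [h2, hgH]; rfl, by simpa using h3, fun q => ?_⟩
    exact Finset.mem_image.mpr ⟨(j, q), by simp [hj], rfl⟩
  · exact fun m n hmn => hD.strictMono (hH (by omega))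
  · exact hD.strictMono (hH (by omega))
  · intro v hv
    obtain ⟨⟨j, q⟩, hjq, rfl⟩ := Finset.mem_image.mp hv
    have := (hw j (Finset.mem_product.mp hjq).1).1.2.1
    simp [this, hgH]
  · intro r v hv
    obtain ⟨⟨j, q⟩, hjq, rfl⟩ := Finset.mem_image.mp hv
    have := (hw j (Finset.mem_product.mp hjq).1).2 q _ (isFan_cons x r)
    simpa [FanDense, hgH] using this

end Step

section Fusion

variable {ι : Type} {A : ι → Type} {B : Type} [Fintype B]

/-- A bundled dense level selection. -/
structure Selection (A : ι → Type) (B : Type) [Fintype B] where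
  /-- the level selection -/
  D : List (∀ i, A i) → Set (List B)
  /-- the level sequence -/
  l : ℕ → ℕ
  /-- the nodes above which the selection is dense -/
  J : Finset (List B)
  /-- the length of the nodes in `J` -/
  lam : ℕ
  /-- the density -/
  ε : ℝ
  denseAbove : DenseAbove D l J lam ε

/-- The data `(g, w)` provides one step of the construction, leading from `σ` to `τ`. -/
structure IsStep (σ τ : Selection A B) (g : List (∀ i, A i) → List (∀ i, A i))
    (w : List B → List B) : Prop where
  strong : Strong g
  le : ∀ j ∈ σ.J, j <+: w j
  length_eq : ∀ j ∈ σ.J, (w j).length = σ.l (g []).length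
  mem : ∀ j ∈ σ.J, w j ∈ σ.D (g [])
  succ_mem : ∀ j ∈ σ.J, ∀ q, w j ++ [q] ∈ τ.J
  level_eq : ∀ p r, σ.l (g (p :: r)).length = τ.l r.length
  subset : ∀ p r, τ.D r ⊆ σ.D (g (p :: r))

lemma exists_isStep [Finite ι] [∀ i, Finite (A i)] [∀ i, Nonempty (A i)] [Fintype (∀ i, A i)]
    [Nonempty B] (hA : DensityHL A) (σ : Selection A B) : ∃ τ g w, IsStep σ τ g w := by
  obtain ⟨g, h, w, J', θ, hg, hgh, hw, hD⟩ := σ.denseAbove.exists_step hA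
  exact ⟨⟨_, _, _, _, _, hD⟩, g, w, hg, fun j hj => (hw j hj).1,
    fun j hj => by rw [(hw j hj).2.1, hgh]; rfl, fun j hj => (hw j hj).2.2.1,
    fun j hj => (hw j hj).2.2.2, fun p r => by rw [hgh]; rfl, fun p r v hv => hv p⟩

variable (next : Selection A B → Selection A B)
  (g : Selection A B → List (∀ i, A i) → List (∀ i, A i)) (w : Selection A B → List B → List B)

/-- The strong subtree obtained by iterating the steps. -/
def fuse (σ : Selection A B) : List (∀ i, A i) → List (∀ i, A i)
  | [] => g σ []
  | p :: u => g σ (p :: fuse (next σ) u)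

/-- The strong subtree of the additional tree obtained by iterating the steps. -/
def fuseNode (σ : Selection A B) (j : List B) : List B → List B
  | [] => w σ j
  | q :: u => fuseNode (next σ) (w σ j ++ [q]) u

variable {next g w}

lemma strong_fuse (h : ∀ σ, IsStep σ (next σ) (g σ) (w σ))
    (σ : Selection A B) : Strong (fuse next g σ) where
  len x := by
    induction x generalizing σ with
    | nil => intro y hy; rw [List.length_nil, eq_comm, List.length_eq_zero_iff] at hy; rw [hy]
    | cons p x ih =>
      intro y hy
      cases y with
      | nil => simp at hy
      | cons q y =>
        refine (h σ).strong.len _ _ ?_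
        simpa using ih (next σ) y (by simpa using hy)
  ext x a := by
    induction x generalizing σ with
    | nil => exact (h σ).strong.ext_append [] a _
    | cons p x ih =>
      refine ((h σ).strong.ext _ a).trans ((h σ).strong.mono ?_)
      simpa using ih (next σ)
  loc i x := by
    induction x generalizing σ with
    | nil =>
      intro y hy
      have : y = [] := by simpa [pr] using hy.symm
      rw [this]
    | cons p x ih =>
      intro y hy
      cases y with
      | nil => simp at hy
      | cons q y =>
        rw [pr_cons, pr_cons] at hy
        obtain ⟨h1, h2⟩ := List.cons.inj hy
        refine (h σ).strong.loc i _ _ ?_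
        rw [pr_cons, pr_cons, h1, ih (next σ) y h2]

lemma prefix_fuseNode (h : ∀ σ, IsStep σ (next σ) (g σ) (w σ))
    (σ : Selection A B) {j : List B} (hj : j ∈ σ.J) (u : List B) :
    j <+: fuseNode next w σ j u := by
  induction u generalizing σ j with
  | nil => exact (h σ).le j hj
  | cons q u ih =>
    exact ((h σ).le j hj).trans ((List.prefix_append _ _).trans
      (ih (next σ) ((h σ).succ_mem j hj q)))

lemma fuseNode_ext (h : ∀ σ, IsStep σ (next σ) (g σ) (w σ))
    (σ : Selection A B) {j : List B} (hj : j ∈ σ.J) (u : List B) (q : B) :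
    fuseNode next w σ j u ++ [q] <+: fuseNode next w σ j (u ++ [q]) := by
  induction u generalizing σ j with
  | nil => exact prefix_fuseNode h (next σ) ((h σ).succ_mem j hj q) []
  | cons r u ih => exact ih (next σ) ((h σ).succ_mem j hj r)

lemma fuseNode_spec (h : ∀ σ, IsStep σ (next σ) (g σ) (w σ))
    (σ : Selection A B) {j : List B} (hj : j ∈ σ.J) (u : List B)
    (x : List (∀ i, A i)) (hux : u.length = x.length) :
    (fuseNode next w σ j u).length = σ.l (fuse next g σ x).length ∧
      fuseNode next w σ j u ∈ σ.D (fuse next g σ x) := by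
  induction u generalizing σ j x with
  | nil =>
    rw [List.length_nil, eq_comm, List.length_eq_zero_iff] at hux
    subst hux
    exact ⟨(h σ).length_eq j hj, (h σ).mem j hj⟩
  | cons q u ih =>
    cases x with
    | nil => simp at hux
    | cons p x =>
      obtain ⟨h1, h2⟩ := ih (next σ) ((h σ).succ_mem j hj q) x (by simpa using hux)
      exact ⟨h1.trans ((h σ).level_eq p _).symm, (h σ).subset p _ h2⟩

end Fusion

section Induction

variable {d : ℕ} {A : Fin (d + 1) → Type}

/-- The word in the product alphabet with given coordinates. -/
def zipCons (w : List (A 0)) (y : List (∀ i : Fin d, A i.succ)) : List (∀ i, A i) :=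
  List.zipWith (Fin.cons : A 0 → (∀ i : Fin d, A i.succ) → ∀ i, A i) w y

lemma pr_zero_zipCons {w : List (A 0)} {y : List (∀ i : Fin d, A i.succ)}
    (h : w.length = y.length) : pr 0 (zipCons w y) = w := by
  refine List.ext_getElem (by simp [zipCons, h]) fun n h1 h2 => ?_
  simp [zipCons, pr]

lemma pr_succ_zipCons {w : List (A 0)} {y : List (∀ i : Fin d, A i.succ)}
    (h : w.length = y.length) (i : Fin d) :
    pr i.succ (zipCons w y) = pr (A := fun i : Fin d => A i.succ) i y := by
  refine List.ext_getElem (by simp [zipCons, h]) fun n h1 h2 => ?_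
  simp [zipCons, pr]

lemma zipCons_prefix {w w' : List (A 0)} {y y' : List (∀ i : Fin d, A i.succ)}
    (h : w.length = y.length) (hw : w <+: w') (hy : y <+: y') : zipCons w y <+: zipCons w' y' := by
  obtain ⟨r, rfl⟩ := hw
  obtain ⟨s, rfl⟩ := hy
  rw [zipCons, zipCons, List.zipWith_append h]
  exact List.prefix_append _ _

lemma zipCons_append_singleton {w : List (A 0)} {y : List (∀ i : Fin d, A i.succ)}
    (h : w.length = y.length) (a : ∀ i, A i) :
    zipCons w y ++ [a] = zipCons (w ++ [a 0]) (y ++ [Fin.tail a]) := by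
  rw [zipCons, zipCons, List.zipWith_append h]
  simp

variable [∀ i, Fintype (A i)]

lemma mean_eq_mean_zipCons (m : ℕ) (ψ : List (∀ i, A i) → ℝ) :
    mean m ψ = mean m (fun y => mean m (fun w => ψ (zipCons w y))) := by
  induction m generalizing ψ with
  | zero => rfl
  | succ m ih =>
    simp only [mean, zipCons, List.zipWith_cons_cons]
    rw [Fintype.sum_equiv (Fin.consEquiv A).symm (fun a => mean m fun s => ψ (a :: s))
      (fun b => mean m fun s => ψ (Fin.cons b.1 b.2 :: s)) (fun a => by simp [Fin.consEquiv]),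
      Fintype.sum_prod_type, Finset.sum_comm,
      Fintype.card_congr (Fin.consEquiv A).symm, Fintype.card_prod]
    simp only [mean_div, mean_sum]
    rw [← Finset.sum_div, div_div, Nat.cast_mul]
    congr 1
    refine Finset.sum_congr rfl fun p _ => Finset.sum_congr rfl fun b _ => ?_
    exact ih _

lemma densityHL_succ [∀ i, Nonempty (A i)] (hA : DensityHL fun i : Fin d => A i.succ) :
    DensityHL A := by
  intro D ε hε hD
  let sec : List (∀ i : Fin d, A i.succ) → ℝ := fun x =>
    mean x.length (fun w => ind (zipCons w x ∈ D))
  obtain ⟨f₀, hf₀, hf₀E⟩ := hA {x | ε / 2 ≤ sec x} (ε / 2) (by positivity) (hD.mono fun m hm => by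
    rw [mean_eq_mean_zipCons] at hm
    have h1 : mean m (fun y : List (∀ i : Fin d, A i.succ) =>
        mean m (fun w => ind (zipCons w y ∈ D)) - ε / 2) ≤
        mean m (fun y => ind (y ∈ {x | ε / 2 ≤ sec x})) := by
      refine mean_mono m fun y hy => ?_
      by_cases h : ε / 2 ≤ sec y
      · rw [ind_true (p := y ∈ {x | ε / 2 ≤ sec x}) h]
        linarith [mean_ind_le_one m fun w => zipCons w y ∈ D]
      · refine le_trans ?_ (ind_nonneg _)
        have := not_le.mp h
        simp only [sec, hy] at this
        linarith
    rw [mean_sub, mean_const] at h1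
    linarith)
  obtain ⟨H, hH, hf₀H⟩ := hf₀.exists_levels
  let σ : Selection (fun i : Fin d => A i.succ) (A 0) :=
    ⟨fun x => {w | zipCons w (f₀ x) ∈ D}, H, {[]}, 0, ε / 2, hH, Nat.zero_le _, by simp,
      by positivity, fun x j hj => by
        rw [Finset.mem_singleton.mp hj, Nat.sub_zero, ← hf₀H]
        exact hf₀E x⟩
  choose next g w h using exists_isStep (B := A 0) hA
  let tl : List (∀ i, A i) → List (∀ i : Fin d, A i.succ) := fun x => x.map Fin.tail
  have hj : [] ∈ σ.J := Finset.mem_singleton_self []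
  have hspec := fun x : List (∀ i, A i) => fuseNode_spec h σ hj (pr 0 x) (tl x) (by simp [tl])
  have hlen : ∀ x : List (∀ i, A i), (fuseNode next w σ [] (pr 0 x)).length =
      (f₀ (fuse next g σ (tl x))).length := fun x => by rw [(hspec x).1, hf₀H]
  have hf := hf₀.comp (strong_fuse h σ)
  refine ⟨fun x => zipCons (fuseNode next w σ [] (pr 0 x)) (f₀ (fuse next g σ (tl x))),
    ⟨fun x y hxy => ?_, fun x a => ?_, fun i x y hxy => ?_⟩, fun x => (hspec x).2⟩
  · rw [zipCons, zipCons, List.length_zipWith, List.length_zipWith, hlen, hlen,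
      hf.len (tl x) (tl y) (by simpa [tl] using hxy)]
  · rw [zipCons_append_singleton (hlen x)]
    refine zipCons_prefix (by simp [hlen x]) ?_ ?_
    · rw [pr_append]
      exact fuseNode_ext h σ hj (pr 0 x) (a 0)
    · have := hf.ext (tl x) (Fin.tail a)
      simpa [tl] using this
  · induction i using Fin.cases with
    | zero => rw [pr_zero_zipCons (hlen x), pr_zero_zipCons (hlen y), hxy]
    | succ i =>
      rw [pr_succ_zipCons (hlen x), pr_succ_zipCons (hlen y)]
      refine hf.loc i _ _ ?_
      simpa [pr, tl, Fin.tail, Function.comp_def] using hxy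

end Induction

/-- The infinite density Halpern–Läuchli theorem. -/
theorem densityHL (d : ℕ) (A : Fin d → Type) [∀ i, Fintype (A i)] [∀ i, Nonempty (A i)] :
    DensityHL A := by
  induction d with
  | zero =>
    intro D ε hε hD
    obtain ⟨l, hl, hlD⟩ := extraction_of_frequently_atTop hD
    have huniq : ∀ x y : List (∀ i, A i), x.length = y.length → x = y :=
      fun x y h => eq_of_pr h fun i => i.elim0
    refine ⟨fun x => List.replicate (l x.length) default, ⟨fun x y h => by simp [h],
      fun x a => ?_, fun i => i.elim0⟩, fun x => ?_⟩
    · have h1 : l x.length < l (x.length + 1) := hl (Nat.lt_succ_self _)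
      refine ⟨List.replicate (l (x.length + 1) - (l x.length + 1)) default, huniq _ _ ?_⟩
      simp
      omega
    · by_contra hx
      have h1 : mean (l x.length) (fun x => ind (x ∈ D)) ≤ 0 :=
        mean_le_of_le _ fun y hy => by
          rw [huniq y (List.replicate (l x.length) default) (by simp [hy]), ind_false hx]
      linarith [hlD x.length]
  | succ d ih => exact densityHL_succ (ih fun i => A i.succ)

section Trees

lemma ncard_strict_prefixes {B : Type} (t : List B) : {s | s <+: t ∧ s ≠ t}.ncard = t.length := by
  have h : {s | s <+: t ∧ s ≠ t} = (fun n => t.take n) '' Set.Iio t.length := by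
    ext s
    constructor
    · rintro ⟨h1, h2⟩
      refine ⟨s.length, lt_of_le_of_ne h1.length_le fun h => h2 (h1.eq_of_length h), ?_⟩
      exact (List.prefix_iff_eq_take.mp h1).symm
    · rintro ⟨n, hn, rfl⟩
      refine ⟨List.take_prefix n t, fun h => ?_⟩
      have := congrArg List.length h
      simp only [List.length_take, Set.mem_Iio] at this hn
      omega
  rw [h, Set.InjOn.ncard_image]
  · simp
  · intro m hm n hn hmn
    have := congrArg List.length hmn
    simp only [List.length_take, Set.mem_Iio] at this hm hn
    omega

lemma mem_bSeq_of_prefix {b : ℕ} {s t : List ℕ} (ht : t ∈ bSeq b) (h : s <+: t) : s ∈ bSeq b :=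
  fun x hx => ht x (h.subset hx)

lemma level_bSeq (b n : ℕ) : level (bSeq b) n = {t | t ∈ bSeq b ∧ t.length = n} := by
  ext t
  refine and_congr_right fun ht => ?_
  rw [← ncard_strict_prefixes t]
  have : {s | s ∈ bSeq b ∧ s <+: t ∧ s ≠ t} = {s | s <+: t ∧ s ≠ t} :=
    Set.ext fun s => and_iff_right_of_imp fun h => mem_bSeq_of_prefix ht h.1
  rw [this]

lemma eq_of_append_singleton_prefix {B : Type} {s t : List B} {p q : B} (hp : s ++ [p] <+: t)
    (hq : s ++ [q] <+: t) : p = q := by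
  have := (List.prefix_of_prefix_length_le hp hq (by simp)).eq_of_length (by simp)
  simpa using this

section Range

variable {b : ℕ} {G : List (Fin b) → List ℕ} {H : ℕ → ℕ}

lemma range_prefix_iff (hH : StrictMono H) (hlen : ∀ u, (G u).length = H u.length)
    (hext : ∀ u (q : Fin b), G u ++ [(q : ℕ)] <+: G (u ++ [q])) (u v : List (Fin b)) :
    G u <+: G v ↔ u <+: v := by
  have hmono : ∀ u r, G u <+: G (u ++ r) := by
    intro u r
    induction r using List.reverseRecOn with
    | nil => simp
    | append_singleton r a ih =>
      rw [← List.append_assoc]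
      exact ih.trans ((List.prefix_append _ _).trans (hext _ a))
  refine ⟨fun h => ?_, fun ⟨r, hr⟩ => hr ▸ hmono u r⟩
  induction u using List.reverseRecOn with
  | nil => exact List.nil_prefix
  | append_singleton u q ih =>
    obtain ⟨r, rfl⟩ := ih ((hmono u [q]).trans h)
    have h1 := h.length_le
    rw [hlen, hlen, hH.le_iff_le] at h1
    cases r with
    | nil => simp at h1
    | cons p r =>
      have h2 : G u ++ [(p : ℕ)] <+: G (u ++ p :: r) :=
        (hext u p).trans (by simpa using hmono (u ++ [p]) r)
      have h3 := Fin.ext (eq_of_append_singleton_prefix h2 ((hext u q).trans h))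
      rw [h3]
      exact ⟨r, by simp⟩

lemma level_range (hiff : ∀ u v, G u <+: G v ↔ u <+: v) (hinj : Function.Injective G) (n : ℕ) :
    level (Set.range G) n = G '' {u | u.length = n} := by
  have h : ∀ u, {s ∈ Set.range G | s <+: G u ∧ s ≠ G u}.ncard = u.length := by
    intro u
    have : {s ∈ Set.range G | s <+: G u ∧ s ≠ G u} = G '' {s | s <+: u ∧ s ≠ u} := by
      ext s
      constructor
      · rintro ⟨⟨v, rfl⟩, h1, h2⟩
        exact ⟨v, ⟨(hiff v u).mp h1, fun h => h2 (h ▸ rfl)⟩, rfl⟩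
      · rintro ⟨v, ⟨h1, h2⟩, rfl⟩
        exact ⟨⟨v, rfl⟩, (hiff v u).mpr h1, fun h => h2 (hinj h)⟩
    rw [this, Set.ncard_image_of_injective _ hinj, ncard_strict_prefixes]
  ext t
  constructor
  · rintro ⟨⟨u, rfl⟩, hu⟩
    exact ⟨u, by rw [Set.mem_ofPred_eq, ← h u, hu], rfl⟩
  · rintro ⟨u, hu, rfl⟩
    exact ⟨⟨u, rfl⟩, (h u).trans hu⟩

lemma injective_of_prefix_iff (hiff : ∀ u v, G u <+: G v ↔ u <+: v) : Function.Injective G :=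
  fun u v h => ((hiff u v).mp (h ▸ List.prefix_rfl)).eq_of_length_le
    ((hiff v u).mp (h ▸ List.prefix_rfl)).length_le

lemma isStrongSubtreeWith_range (hH : StrictMono H) (hlen : ∀ u, (G u).length = H u.length)
    (hext : ∀ u (q : Fin b), G u ++ [(q : ℕ)] <+: G (u ++ [q])) (hmem : ∀ u, G u ∈ bSeq b) :
    IsStrongSubtreeWith (bSeq b) (Set.range G) H := by
  have hiff := range_prefix_iff hH hlen hext
  have hinj := injective_of_prefix_iff hiff
  refine ⟨Set.range_subset_iff.mpr hmem, ⟨G [], ?_, fun r hr => ?_⟩, hH, fun n => ?_, ?_⟩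
  · change G [] ∈ level (Set.range G) 0
    rw [level_range hiff hinj]
    exact ⟨[], rfl, rfl⟩
  · change r ∈ level (Set.range G) 0 at hr
    rw [level_range hiff hinj] at hr
    obtain ⟨u, hu, rfl⟩ := hr
    rw [List.length_eq_zero_iff.mp hu]
  · rw [level_range hiff hinj, level_bSeq]
    rintro _ ⟨u, hu, rfl⟩
    exact ⟨hmem u, by rw [hlen, hu]⟩
  · rintro _ ⟨u, rfl⟩ t ⟨-, ht, ⟨r, rfl⟩, hne, himm⟩
    cases r with
    | nil => simp at hne
    | cons q r =>
      have hpre : G u ++ [q] <+: G u ++ q :: r := ⟨r, by simp⟩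
      have hq : q < b := ht q (by simp)
      have heq : G u ++ [q] = G u ++ q :: r :=
        (himm _ (mem_bSeq_of_prefix ht hpre) (List.prefix_append _ _) hpre).resolve_left
          (by simp)
      rw [← heq]
      refine ⟨G (u ++ [⟨q, hq⟩]), ⟨⟨⟨u, rfl⟩, ⟨_, rfl⟩, (hiff _ _).mpr (List.prefix_append _ _),
        fun h => ?_, ?_⟩, hext u ⟨q, hq⟩⟩, ?_⟩
      · simpa using hinj h
      · rintro _ ⟨v, rfl⟩ h1 h2
        obtain ⟨s, rfl⟩ := (hiff _ _).mp h1
        have h3 := (hiff _ _).mp h2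
        rw [List.prefix_append_right_inj] at h3
        cases s with
        | nil => left; simp
        | cons p s =>
          right
          rw [h3.eq_of_length_le (by simp)]
      · rintro _ ⟨⟨-, ⟨v, rfl⟩, h1, h2, h3⟩, h4⟩
        obtain ⟨s, rfl⟩ := (hiff _ _).mp h1
        cases s with
        | nil => simp at h2
        | cons p s =>
          have h5 : G (u ++ [p]) = G (u ++ p :: s) :=
            (h3 _ ⟨_, rfl⟩ ((hiff _ _).mpr (List.prefix_append _ _))
              ((hiff _ _).mpr ⟨s, by simp⟩)).resolve_left fun h => by simpa using hinj h
          rw [← h5] at h4 ⊢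
          have h6 : q = (p : ℕ) := eq_of_append_singleton_prefix h4 (hext u p)
          congr 3
          exact Fin.ext h6.symm

end Range

section Coordinates

variable {d : ℕ} {b : Fin d → ℕ}

/-- The tuple of words of natural numbers given by a word in the product alphabet. -/
def coord (x : List (∀ i, Fin (b i))) (i : Fin d) : List ℕ := (pr i x).map Fin.val

lemma coord_mem (x : List (∀ i, Fin (b i))) (i : Fin d) : coord x i ∈ bSeq (b i) := by
  intro n hn
  obtain ⟨q, -, rfl⟩ := List.mem_map.mp hn
  exact q.2

lemma vecLevel_bSeq_inter (m : ℕ) (D : Set (Fin d → List ℕ)) :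
    D ∩ vecLevel (fun i => bSeq (b i)) m =
      coord '' {x : List (∀ i, Fin (b i)) | x.length = m ∧ coord x ∈ D} := by
  ext v
  constructor
  · rintro ⟨hvD, hv⟩
    have hv' : ∀ i, v i ∈ bSeq (b i) ∧ (v i).length = m := fun i => by
      have := hv i
      rwa [level_bSeq] at this
    have h1 : ∀ i, ∃ u : List (Fin (b i)), u.map Fin.val = v i := fun i =>
      ⟨(v i).attach.map fun n => ⟨n.1, (hv' i).1 n.1 n.2⟩, by simp [Function.comp_def]⟩
    choose u hu using h1
    obtain ⟨x, hx, hxu⟩ := exists_word (m := m) u fun i => by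
      rw [← (hv' i).2, ← hu i, List.length_map]
    have hxv : coord x = v := funext fun i => by rw [coord, hxu, hu]
    exact ⟨x, ⟨hx, hxv ▸ hvD⟩, hxv⟩
  · rintro ⟨x, ⟨hx, hxD⟩, rfl⟩
    refine ⟨hxD, fun i => ?_⟩
    rw [level_bSeq]
    exact ⟨coord_mem x i, by simp [coord, hx]⟩

lemma coord_injOn (m : ℕ) (P : List (∀ i, Fin (b i)) → Prop) :
    Set.InjOn coord {x : List (∀ i, Fin (b i)) | x.length = m ∧ P x} := by
  intro x hx y hy hxy
  refine eq_of_pr (hx.1.trans hy.1.symm) fun i => ?_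
  exact List.map_injective_iff.mpr Fin.val_injective (congrFun hxy i)

lemma ncard_inter_vecLevel [∀ i, Nonempty (Fin (b i))] (m : ℕ) (D : Set (Fin d → List ℕ)) :
    ((D ∩ vecLevel (fun i => bSeq (b i)) m).ncard : ℝ) =
      mean m (fun x : List (∀ i, Fin (b i)) => ind (coord x ∈ D)) *
        (Fintype.card (∀ i, Fin (b i)) : ℝ) ^ m := by
  rw [vecLevel_bSeq_inter, (coord_injOn m _).ncard_image, ncard_words_eq_mean]

lemma le_mean_of_le_ncard [∀ i, Nonempty (Fin (b i))] {m : ℕ} {D : Set (Fin d → List ℕ)} {ε : ℝ}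
    (h : ε * ((vecLevel (fun i => bSeq (b i)) m).ncard : ℝ) ≤
      ((D ∩ vecLevel (fun i => bSeq (b i)) m).ncard : ℝ)) :
    ε ≤ mean m (fun x : List (∀ i, Fin (b i)) => ind (coord x ∈ D)) := by
  rw [ncard_inter_vecLevel, ← Set.univ_inter (vecLevel _ m), ncard_inter_vecLevel] at h
  have h1 : mean m (fun x : List (∀ i, Fin (b i)) => ind (coord x ∈ Set.univ)) = 1 := by
    simp only [ind_true (Set.mem_univ _), mean_const]
  rw [h1, one_mul] at h
  have : (0 : ℝ) < Fintype.card (∀ i, Fin (b i)) := by exact_mod_cast Fintype.card_pos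
  exact le_of_mul_le_mul_right h (by positivity)

/-- A strong map describes a vector strong subtree. -/
lemma Strong.exists_vecStrongSubtree [∀ i, Nonempty (Fin (b i))]
    {F : List (∀ i, Fin (b i)) → List (∀ i, Fin (b i))} (hF : Strong F) :
    ∃ S : Fin d → Set (List ℕ), IsVecStrongSubtree (fun i => bSeq (b i)) S ∧
      ∀ i m, level (S i) m = {t | ∃ x, x.length = m ∧ coord (F x) i = t} := by
  classical
  obtain ⟨a⟩ : Nonempty (∀ i, Fin (b i)) := inferInstance
  obtain ⟨H, hH, hFH⟩ := hF.exists_levels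
  let lift : ∀ i, List (Fin (b i)) → List (∀ i, Fin (b i)) := fun i u =>
    u.map fun q => Function.update a i q
  have hlift : ∀ i u, pr i (lift i u) = u := fun i u => by simp [pr, lift, Function.comp_def]
  let G : ∀ i, List (Fin (b i)) → List ℕ := fun i u => coord (F (lift i u)) i
  have hlen : ∀ i u, (G i u).length = H u.length := fun i u => by simp [G, coord, hFH, lift]
  have hext : ∀ i u (q : Fin (b i)), G i u ++ [(q : ℕ)] <+: G i (u ++ [q]) := by
    intro i u q
    have h1 := (((hF.ext (lift i u) (Function.update a i q)).map fun c => c i).map Fin.val)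
    simpa [G, lift, coord, pr] using h1
  refine ⟨fun i => Set.range (G i), ⟨H, fun i => isStrongSubtreeWith_range hH (hlen i) (hext i)
    fun u => coord_mem _ i⟩, fun i m => ?_⟩
  have hiff := range_prefix_iff hH (hlen i) (hext i)
  rw [level_range hiff (injective_of_prefix_iff hiff)]
  ext t
  constructor
  · rintro ⟨u, hu, rfl⟩
    exact ⟨lift i u, by simpa [lift] using hu, rfl⟩
  · rintro ⟨x, hx, rfl⟩
    refine ⟨pr i x, by simpa using hx, ?_⟩
    simp only [G, coord]
    rw [hF.loc i _ x (hlift i _)]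

end Coordinates

end Trees

/-- Theorem 6.1: the finite version of the density Halpern–Läuchli
theorem. -/
theorem finite_density_halpern_lauchli (ε : ℝ) (hε0 : 0 < ε) (hε1 : ε ≤ 1)
    (k : ℕ) (hk : 1 ≤ k) (d : ℕ) (hd : 1 ≤ d) (b : Fin d → ℕ) (hb : ∀ i, 2 ≤ b i) :
    ∃ N : ℕ, ∀ n, N < n → ∀ D : Set (Fin d → List ℕ),
      D ⊆ (⋃ m ∈ Set.Iio n, vecLevel (fun i => bSeq (b i)) m) →
      (∀ m < n, ε * ((vecLevel (fun i => bSeq (b i)) m).ncard : ℝ)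
          ≤ ((D ∩ vecLevel (fun i => bSeq (b i)) m).ncard : ℝ)) →
      ∃ S : Fin d → Set (List ℕ),
        IsVecStrongSubtree (fun i => bSeq (b i)) S ∧
        (∀ i, ∀ m < k, ∀ t ∈ level (S i) m, t.length < n) ∧
        (∀ m < k, vecLevel S m ⊆ D) := by
  have hne : ∀ i, Nonempty (Fin (b i)) := fun i => ⟨⟨0, by have := hb i; omega⟩⟩
  by_contra! hcon
  choose n hn D hDsub hDdens hbad using hcon
  let U := hyperfilter ℕ
  let E : Set (List (∀ i, Fin (b i))) := {x | ∀ᶠ N in U, coord x ∈ D N}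
  have hlarge : ∀ m, ∀ᶠ N in U, m < n N := by
    intro m
    have h1 : ∀ᶠ N in atTop, m ≤ N := eventually_ge_atTop m
    rw [← Nat.cofinite_eq_atTop] at h1
    filter_upwards [hyperfilter_le_cofinite h1] with N hN
    exact lt_of_le_of_lt hN (hn N)
  have hE : ∀ m, ε ≤ mean m (fun x => ind (x ∈ E)) := by
    intro m
    have h1 : ∀ᶠ N in U, ∀ x ∈ {x : List (∀ i, Fin (b i)) | x.length = m},
        (x ∈ E ↔ coord x ∈ D N) :=
      (eventually_all_finite (List.finite_length_eq _ m)).mpr fun x _ =>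
        ultrafilter_eventually_iff U _
    obtain ⟨N, hN, hmN⟩ := (h1.and (hlarge m)).exists
    exact (le_mean_of_le_ncard (hDdens N m hmN)).trans
      (mean_mono m fun x hx => ind_mono (hN x hx).mpr)
  obtain ⟨F, hF, hFE⟩ := densityHL d (fun i => Fin (b i)) E ε hε0
    (Frequently.of_forall hE)
  obtain ⟨S, hS, hlevel⟩ := hF.exists_vecStrongSubtree
  have h1 : ∀ᶠ N in U, ∀ x ∈ {x : List (∀ i, Fin (b i)) | x.length < k},
      coord (F x) ∈ D N ∧ (F x).length < n N :=
    (eventually_all_finite (List.finite_length_lt _ k)).mpr fun x _ =>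
      (hFE x).and (hlarge _)
  obtain ⟨N, hN⟩ := h1.exists
  obtain ⟨m, hm, hmD⟩ := hbad N S hS (by
    intro i m hm t ht
    rw [hlevel] at ht
    obtain ⟨x, hx, rfl⟩ := ht
    simpa [coord] using (hN x (by simpa [hx] using hm)).2)
  refine hmD fun v hv => ?_
  have h2 : ∀ i, ∃ x, x.length = m ∧ coord (F x) i = v i := fun i => by
    have := hv i
    rwa [hlevel] at this
  choose y hy hyv using h2
  obtain ⟨x, hx, hxy⟩ := exists_word (m := m) (fun i => pr i (y i)) fun i => by simp [hy i]
  have hxv : coord (F x) = v := funext fun i => by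
    rw [← hyv i, coord, coord, hF.loc i x (y i) (hxy i)]
  exact hxv ▸ (hN x (by simpa [hx] using hm)).1
end DHLPaper
end

section
/- (DHL(1), Bicker–Voigt.) For every homogeneous tree T and every subset D of T satisfying limsup_{n→∞} |D ∩ T(n)| / |T(n)| > 0, there exists a strong subtree S of T with S ⊆ D. -/
open Filter

namespace DHLPaper

/-! ### Embeddings of the tree of words -/

section Embedding

variable {b : ℕ}

/-- `χ` sends a word (read from right to left) to a sequence in such a way that the image of
`p :: t` extends the image of `t` followed by `p`. -/
def IsTreeEmb (χ : List (Fin b) → List ℕ) : Prop :=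
  ∀ (p : Fin b) (t : List (Fin b)), χ t ++ [(p : ℕ)] <+: χ (p :: t)

theorem append_singleton_prefix_unique {s u : List ℕ} {x y : ℕ}
    (hx : s ++ [x] <+: u) (hy : s ++ [y] <+: u) : x = y := by
  have h := (List.prefix_of_prefix_length_le hx hy (by simp)).eq_of_length (by simp)
  simpa using h

theorem IsTreeEmb.mono {χ : List (Fin b) → List ℕ} (hχ : IsTreeEmb χ)
    {t t' : List (Fin b)} (h : t <:+ t') : χ t <+: χ t' := by
  obtain ⟨v, rfl⟩ := h
  induction v with
  | nil => simp
  | cons a v ih => exact ih.trans ((List.prefix_append _ _).trans (hχ a _))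

theorem IsTreeEmb.prefix_iff {χ : List (Fin b) → List ℕ} (hχ : IsTreeEmb χ)
    {t t' : List (Fin b)} : χ t <+: χ t' ↔ t <:+ t' := by
  refine ⟨fun h => ?_, hχ.mono⟩
  induction t with
  | nil => exact List.nil_suffix
  | cons p t ih =>
    have h1 : χ t ++ [(p : ℕ)] <+: χ t' := (hχ p t).trans h
    obtain ⟨v, rfl⟩ := ih ((List.prefix_append _ _).trans h1)
    rcases List.eq_nil_or_concat v with rfl | ⟨v, q, rfl⟩
    · have := h1.length_le
      simp at this
    · have hq : q :: t <:+ (v ++ [q]) ++ t := ⟨v, by simp⟩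
      have hpq : (p : ℕ) = q :=
        append_singleton_prefix_unique h1 ((hχ q t).trans (by simpa using hχ.mono hq))
      simp [Fin.ext hpq]

theorem IsTreeEmb.injective {χ : List (Fin b) → List ℕ} (hχ : IsTreeEmb χ) :
    Function.Injective χ := fun t t' h => by
  have h1 : t <:+ t' := hχ.prefix_iff.1 (by rw [h])
  have h2 : t' <:+ t := hχ.prefix_iff.1 (by rw [h])
  exact h1.eq_of_length_le h2.length_le

theorem finite_setOf_suffix {α : Type*} (t : List α) : {s | s <:+ t}.Finite := by
  refine (List.finite_toSet t.tails).subset fun s hs => ?_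
  simpa using hs

theorem ncard_proper_suffix {α : Type*} (t : List α) :
    {s | s <:+ t ∧ s ≠ t}.ncard = t.length := by
  induction t with
  | nil => simp
  | cons a t ih =>
    have h : {s | s <:+ a :: t ∧ s ≠ a :: t} = insert t {s | s <:+ t ∧ s ≠ t} := by
      ext s
      simp only [Set.mem_ofPred_eq, Set.mem_insert_iff, List.suffix_cons_iff]
      constructor
      · rintro ⟨rfl | h, h'⟩
        · exact absurd rfl h'
        · by_cases hs : s = t
          · exact Or.inl hs
          · exact Or.inr ⟨h, hs⟩
      · have key : s <:+ t → s ≠ a :: t := by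
          rintro h rfl
          simpa using h.length_le
        rintro (rfl | ⟨h, -⟩)
        · exact ⟨Or.inr List.suffix_rfl, key List.suffix_rfl⟩
        · exact ⟨Or.inr h, key h⟩
    rw [h, Set.ncard_insert_of_notMem (by simp)
      ((finite_setOf_suffix t).subset fun s hs => hs.1), ih, List.length_cons]

theorem IsTreeEmb.level_range {χ : List (Fin b) → List ℕ} (hχ : IsTreeEmb χ) (n : ℕ) :
    level (Set.range χ) n = χ '' {t | t.length = n} := by
  have key : ∀ t, {s ∈ Set.range χ | s <+: χ t ∧ s ≠ χ t}.ncard = t.length := fun t => by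
    rw [← ncard_proper_suffix t, ← Set.ncard_image_of_injective _ hχ.injective]
    congr 1
    ext s
    constructor
    · rintro ⟨⟨u, rfl⟩, h, h'⟩
      exact ⟨u, ⟨hχ.prefix_iff.1 h, fun e => h' (e ▸ rfl)⟩, rfl⟩
    · rintro ⟨u, ⟨h, h'⟩, rfl⟩
      exact ⟨⟨u, rfl⟩, hχ.mono h, fun e => h' (hχ.injective e)⟩
  ext s
  constructor
  · rintro ⟨⟨t, rfl⟩, h⟩
    exact ⟨t, (key t).symm.trans h, rfl⟩
  · rintro ⟨t, h, rfl⟩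
    exact ⟨⟨t, rfl⟩, (key t).trans h⟩

theorem IsTreeEmb.immSuc_range_iff {χ : List (Fin b) → List ℕ} (hχ : IsTreeEmb χ)
    {t : List (Fin b)} {s : List ℕ} :
    ImmSuc (Set.range χ) (χ t) s ↔ ∃ p, s = χ (p :: t) := by
  constructor
  · rintro ⟨-, ⟨t', rfl⟩, h, hne, hmin⟩
    obtain ⟨v, rfl⟩ := hχ.prefix_iff.1 h
    rcases List.eq_nil_or_concat v with rfl | ⟨v, q, rfl⟩
    · exact absurd rfl hne
    · refine ⟨q, ?_⟩
      rcases hmin (χ (q :: t)) ⟨_, rfl⟩ (hχ.mono (List.suffix_cons _ _))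
        (hχ.mono ⟨v, by simp⟩) with h' | h'
      · simpa using hχ.injective h'
      · exact h'.symm
  · rintro ⟨p, rfl⟩
    refine ⟨⟨t, rfl⟩, ⟨_, rfl⟩, hχ.mono (List.suffix_cons _ _), fun h => ?_, ?_⟩
    · simpa using hχ.injective h
    · rintro _ ⟨u, rfl⟩ h1 h2
      rcases List.suffix_cons_iff.1 (hχ.prefix_iff.1 h2) with rfl | h3
      · exact Or.inr rfl
      · have h4 := hχ.prefix_iff.1 h1
        exact Or.inl (congrArg χ (h3.eq_of_length_le h4.length_le))

/-- A length-homogeneous self-map of the tree of words which respects immediate successors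
carries `range φ` to a strong subtree. -/
theorem IsTreeEmb.isStrongSubtree_range_comp {φ : List (Fin b) → List ℕ} (hφ : IsTreeEmb φ)
    {ψ : List (Fin b) → List (Fin b)} (hψ : ∀ p t, p :: ψ t <:+ ψ (p :: t))
    {l : ℕ → ℕ} (hl : StrictMono l) (hψl : ∀ t, (ψ t).length = l t.length) :
    IsStrongSubtree (Set.range φ) (Set.range (φ ∘ ψ)) := by
  have hχ : IsTreeEmb (φ ∘ ψ) := fun p t => (hφ p (ψ t)).trans (hφ.mono (hψ p t))
  refine ⟨l, Set.range_comp_subset_range _ _, ?_, hl, fun n => ?_, ?_⟩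
  · refine ⟨φ (ψ []), ?_, fun s hs => ?_⟩
    · rw [hχ.level_range]
      exact ⟨[], rfl, rfl⟩
    · rw [hχ.level_range] at hs
      obtain ⟨t, ht, rfl⟩ := hs
      rw [List.length_eq_zero_iff.1 ht]
      rfl
  · rw [hχ.level_range, hφ.level_range]
    rintro _ ⟨t, rfl, rfl⟩
    exact ⟨ψ t, hψl t, rfl⟩
  · rintro _ ⟨t, rfl⟩ u hu
    obtain ⟨p, rfl⟩ := hφ.immSuc_range_iff.1 hu
    refine ⟨φ (ψ (p :: t)), ⟨hχ.immSuc_range_iff.2 ⟨p, rfl⟩, hφ.mono (hψ p t)⟩, ?_⟩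
    rintro s' ⟨h1, h2⟩
    obtain ⟨q, rfl⟩ := hχ.immSuc_range_iff.1 h1
    have h3 := hφ.prefix_iff.1 h2
    have h4 := (List.suffix_of_suffix_length_le h3 (hψ q t) (by simp)).eq_of_length (by simp)
    rw [(List.cons.inj h4).1]
    rfl

theorem immSuc_bSeq {s : List ℕ} (hs : s ∈ bSeq b) {p : ℕ} (hp : p < b) :
    ImmSuc (bSeq b) s (s ++ [p]) := by
  refine ⟨hs, fun x hx => ?_, List.prefix_append _ _, by simp, fun u _ h1 h2 => ?_⟩
  · rcases List.mem_append.1 hx with h | h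
    · exact hs x h
    · rw [List.mem_singleton.1 h]
      exact hp
  · rcases List.prefix_concat_iff.1 h2 with h | h
    · exact Or.inr (by simpa using h)
    · exact Or.inl (h.eq_of_length_le h1.length_le)

/-- Every homogeneous tree is the range of an embedding of the full tree of words. -/
theorem IsHomogeneous.exists_isTreeEmb {T : Set (List ℕ)} (hT : IsHomogeneous b T) :
    ∃ φ : List (Fin b) → List ℕ, IsTreeEmb φ ∧ Set.range φ = T := by
  obtain ⟨-, l, hsub, ⟨r, hr, hr'⟩, -, -, hsuc⟩ := hT
  have H : ∀ (s : T) (p : Fin b), ∃ s' : T, (s : List ℕ) ++ [(p : ℕ)] <+: s' ∧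
      ∀ u, ImmSuc T s u → (s : List ℕ) ++ [(p : ℕ)] <+: u → u = s' := fun s p => by
    obtain ⟨s', ⟨h1, h2⟩, h3⟩ := hsuc s s.2 _ (immSuc_bSeq (hsub s.2) p.2)
    exact ⟨⟨s', h1.2.1⟩, h2, fun u hu hu' => h3 u ⟨hu, hu'⟩⟩
  choose next hnext huniq using H
  let f : List (Fin b) → T := fun t => t.rec ⟨r, hr.1⟩ fun p _ s => next s p
  refine ⟨fun t => (f t).1, fun p t => hnext (f t) p, ?_⟩
  refine Set.Subset.antisymm (by rintro _ ⟨t, rfl⟩; exact (f t).2) ?_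
  have main : ∀ n, ∀ x ∈ T, x.length = n → ∃ t, (f t).1 = x := by
    intro n
    induction n using Nat.strong_induction_on with
    | _ n ih =>
      intro x hx hxn
      have hfin : {s ∈ T | s <+: x ∧ s ≠ x}.Finite := by
        refine (List.finite_toSet x.inits).subset fun s hs => ?_
        simpa using hs.2.1
      rcases Set.eq_empty_or_nonempty {s ∈ T | s <+: x ∧ s ≠ x} with h0 | h0
      · exact ⟨[], (hr' x ⟨hx, by rw [h0, Set.ncard_empty]⟩).symm⟩
      · obtain ⟨y, ⟨hyT, hyx, hne⟩, hmax⟩ := Set.exists_max_image _ List.length hfin h0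
        have hlt : y.length < x.length :=
          lt_of_not_ge fun h => hne (hyx.eq_of_length_le h)
        obtain ⟨t, ht⟩ := ih y.length (hxn ▸ hlt) y hyT rfl
        obtain ⟨v, rfl⟩ := hyx
        cases v with
        | nil => simp at hne
        | cons q v =>
          have hq : q < b := hsub hx q (by simp)
          refine ⟨⟨q, hq⟩ :: t, (huniq (f t) ⟨q, hq⟩ _ ?_ ?_).symm⟩
          · rw [ht]
            refine ⟨hyT, hx, List.prefix_append _ _, by simp, fun u hu h1 h2 => ?_⟩
            by_cases hux : u = y ++ q :: v
            · exact Or.inr hux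
            · exact Or.inl (h1.eq_of_length_le (hmax u ⟨hu, h2, hux⟩)).symm
          · rw [ht]
            exact ⟨v, by simp⟩
  exact fun x hx => main _ x hx rfl

end Embedding

/-! ### Densities of sets of words -/

section Density

variable {α : Type*} [Fintype α]

/-- The density of a set of words among the words of length `n`. -/
noncomputable def wordDens (n : ℕ) (A : Set (List α)) : ℝ :=
  ({t ∈ A | t.length = n}.ncard : ℝ) / (Fintype.card α : ℝ) ^ n

theorem finite_words (n : ℕ) (A : Set (List α)) : {t ∈ A | t.length = n}.Finite :=
  (List.finite_length_eq α n).subset fun _ h => h.2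

theorem ncard_words (n : ℕ) : {t : List α | t.length = n}.ncard = Fintype.card α ^ n := by
  rw [← card_vector, ← Nat.card_eq_fintype_card]
  rfl

theorem wordDens_nonneg (n : ℕ) (A : Set (List α)) : 0 ≤ wordDens n A := by
  unfold wordDens
  positivity

theorem wordDens_mono {n : ℕ} {A B : Set (List α)}
    (h : ∀ t ∈ A, t.length = n → t ∈ B) : wordDens n A ≤ wordDens n B := by
  unfold wordDens
  have key := Set.ncard_le_ncard (s := {t ∈ A | t.length = n}) (t := {t ∈ B | t.length = n})
    (fun t ht => ⟨h t ht.1 ht.2, ht.2⟩) (finite_words n B)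
  gcongr

theorem wordDens_le_one (n : ℕ) (A : Set (List α)) : wordDens n A ≤ 1 := by
  refine div_le_one_of_le₀ ?_ (by positivity)
  rw [← Nat.cast_pow, ← ncard_words n]
  exact_mod_cast Set.ncard_le_ncard (s := {t ∈ A | t.length = n})
    (fun t ht => ht.2) (List.finite_length_eq α n)

theorem wordDens_union_le (n : ℕ) (A B : Set (List α)) :
    wordDens n (A ∪ B) ≤ wordDens n A + wordDens n B := by
  unfold wordDens
  rw [← add_div]
  gcongr
  have h : {t ∈ A ∪ B | t.length = n} = {t ∈ A | t.length = n} ∪ {t ∈ B | t.length = n} :=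
    Set.union_inter_distrib_right _ _ _
  rw [h]
  exact_mod_cast Set.ncard_union_le _ _

theorem wordDens_add_of_disjoint (n : ℕ) {A B : Set (List α)} (hAB : Disjoint A B) :
    wordDens n (A ∪ B) = wordDens n A + wordDens n B := by
  unfold wordDens
  rw [← add_div]
  have h : {t ∈ A ∪ B | t.length = n} = {t ∈ A | t.length = n} ∪ {t ∈ B | t.length = n} :=
    Set.union_inter_distrib_right _ _ _
  rw [h, Set.ncard_union_eq (hAB.mono (fun _ h => h.1) fun _ h => h.1)
    (finite_words n A) (finite_words n B), Nat.cast_add]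

theorem wordDens_le_succ [Nonempty α] {n : ℕ} {A B : Set (List α)}
    (h : ∀ t ∈ A, t.length = n → ∀ p, p :: t ∈ B) : wordDens n A ≤ wordDens (n + 1) B := by
  have hc : (0 : ℝ) < Fintype.card α := by exact_mod_cast Fintype.card_pos
  have key : Fintype.card α * {t ∈ A | t.length = n}.ncard ≤
      {t ∈ B | t.length = n + 1}.ncard := by
    have hinj : Function.Injective fun x : α × List α => x.1 :: x.2 := fun x y hxy => by
      simpa [Prod.ext_iff] using hxy
    rw [← Nat.card_eq_fintype_card, ← Set.ncard_univ, ← Set.ncard_prod,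
      ← Set.ncard_image_of_injective _ hinj]
    refine Set.ncard_le_ncard ?_ (finite_words _ B)
    rintro _ ⟨⟨p, t⟩, ⟨-, ht⟩, rfl⟩
    exact ⟨h t ht.1 ht.2 p, by simp [ht.2]⟩
  unfold wordDens
  rw [div_le_div_iff₀ (by positivity) (by positivity), pow_succ']
  have key' : (Fintype.card α : ℝ) * {t ∈ A | t.length = n}.ncard ≤
      {t ∈ B | t.length = n + 1}.ncard := by exact_mod_cast key
  have := mul_le_mul_of_nonneg_right key' (pow_nonneg hc.le n)
  linarith

theorem wordDens_le_card_mul_succ [Nonempty α] {n : ℕ} {A B : Set (List α)}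
    (h : ∀ t ∈ A, t.length = n → ∃ p, p :: t ∈ B) :
    wordDens n A ≤ Fintype.card α * wordDens (n + 1) B := by
  have hc : (0 : ℝ) < Fintype.card α := by exact_mod_cast Fintype.card_pos
  have key : {t ∈ A | t.length = n}.ncard ≤ {t ∈ B | t.length = n + 1}.ncard := by
    refine le_trans (Set.ncard_le_ncard ?_ ((finite_words (n + 1) B).image List.tail))
      (Set.ncard_image_le (finite_words _ B))
    rintro t ⟨ht, htn⟩
    obtain ⟨p, hp⟩ := h t ht htn
    exact ⟨p :: t, ⟨hp, by simp [htn]⟩, rfl⟩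
  unfold wordDens
  rw [pow_succ', ← mul_div_assoc, mul_div_mul_left _ _ hc.ne']
  gcongr

/-- The node `w` is null for `D` along `U` if the density of `D` above `w` tends to `0`. -/
def nullNodes (U : Ultrafilter ℕ) (D : Set (List α)) : Set (List α) :=
  {w | Tendsto (fun n => wordDens n (D ∩ {t | w <:+ t})) U (nhds 0)}

theorem cons_mem_nullNodes {U : Ultrafilter ℕ} {D : Set (List α)} {w : List α}
    (hw : w ∈ nullNodes U D) (p : α) : p :: w ∈ nullNodes U D := by
  refine squeeze_zero (fun n => wordDens_nonneg n _) (fun _ => wordDens_mono ?_) hw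
  exact fun _ ht _ => ⟨ht.1, (List.suffix_cons p w).trans ht.2⟩

theorem mem_nullNodes_of_suffix {U : Ultrafilter ℕ} {D : Set (List α)} {w t : List α}
    (hw : w ∈ nullNodes U D) (h : w <:+ t) : t ∈ nullNodes U D := by
  obtain ⟨v, rfl⟩ := h
  induction v with
  | nil => exact hw
  | cons p v ih => exact cons_mem_nullNodes ih p

theorem tendsto_wordDens_above_nullNodes (U : Ultrafilter ℕ) (D : Set (List α)) (k : ℕ) :
    Tendsto (fun n => wordDens n
      (D ∩ {t | ∃ w ∈ nullNodes U D, w.length = k ∧ w <:+ t})) U (nhds 0) := by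
  have key : ∀ F : Set (List α), F.Finite → F ⊆ nullNodes U D →
      Tendsto (fun n => wordDens n (D ∩ {t | ∃ w ∈ F, w <:+ t})) U (nhds 0) := by
    intro F hF
    induction F, hF using Set.Finite.induction_on with
    | empty => simp [wordDens]
    | @insert a F _ _ ih =>
      intro hsub
      have h1 : Tendsto (fun n => wordDens n (D ∩ {t | a <:+ t})) U (nhds 0) :=
        hsub (Set.mem_insert _ _)
      have h2 := h1.add (ih ((Set.subset_insert _ _).trans hsub))
      rw [add_zero] at h2
      refine squeeze_zero (fun n => wordDens_nonneg n _) (fun n => ?_) h2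
      refine le_trans (wordDens_mono ?_) (wordDens_union_le n _ _)
      rintro t ⟨htD, w, rfl | hw, hwt⟩ -
      · exact Or.inl ⟨htD, hwt⟩
      · exact Or.inr ⟨htD, w, hw, hwt⟩
  refine (key _ (finite_words k (nullNodes U D)) fun _ h => h.1).congr fun n => ?_
  simp [and_assoc]

/-- The part of `D` lying at nodes with a null immediate successor is negligible. -/
theorem tendsto_wordDens_inter_parents_nullNodes [Nonempty α] {U : Ultrafilter ℕ}
    (hU : (U : Filter ℕ) ≤ atTop) (D : Set (List α)) :
    Tendsto (fun n => wordDens n (D ∩ {t | ∃ p, p :: t ∈ nullNodes U D})) U (nhds 0) := by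
  set Z := nullNodes U D with hZ
  let E : ℕ → Set (List α) := fun k => {t | ∃ w ∈ Z, w.length = k ∧ w <:+ t}
  have hc : (0 : ℝ) < Fintype.card α := by exact_mod_cast Fintype.card_pos
  have hmono : Monotone fun n => wordDens n Z :=
    monotone_nat_of_le_succ fun n => wordDens_le_succ fun t ht _ => cons_mem_nullNodes ht
  have hbdd : BddAbove (Set.range fun n => wordDens n Z) :=
    ⟨1, by rintro _ ⟨n, rfl⟩; exact wordDens_le_one n Z⟩
  have hlim := tendsto_atTop_ciSup hmono hbdd
  set a := ⨆ n, wordDens n Z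
  have hEZ : ∀ k n, k ≤ n → wordDens k Z ≤ wordDens n (E k) := by
    intro k n hkn
    induction n, hkn using Nat.le_induction with
    | base => exact wordDens_mono fun t ht htk => ⟨t, ht, htk, List.suffix_rfl⟩
    | succ n _ ih =>
      refine ih.trans (wordDens_le_succ ?_)
      rintro t ⟨w, hw, hwk, hwt⟩ - p
      exact ⟨w, hw, hwk, hwt.trans (List.suffix_cons p t)⟩
  have hdiff : ∀ k n, k ≤ n → wordDens n (Z \ E k) ≤ a - wordDens k Z := by
    intro k n hkn
    have h1 := wordDens_add_of_disjoint n (Set.disjoint_sdiff_left (s := E k) (t := Z))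
    have h2 : wordDens n (Z \ E k ∪ E k) ≤ wordDens n Z := by
      refine wordDens_mono ?_
      rintro t (h | ⟨w, hw, -, hwt⟩) -
      · exact h.1
      · exact mem_nullNodes_of_suffix hw hwt
    have h3 : wordDens n Z ≤ a := le_ciSup hbdd n
    have h4 := hEZ k n hkn
    linarith
  have hbound : ∀ k n, k ≤ n → wordDens n (D ∩ {t | ∃ p, p :: t ∈ Z}) ≤
      wordDens n (D ∩ E k) + Fintype.card α * (a - wordDens k Z) := by
    intro k n hkn
    have h1 : wordDens n ({t | ∃ p, p :: t ∈ Z} \ E k) ≤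
        Fintype.card α * wordDens (n + 1) (Z \ E k) := by
      refine wordDens_le_card_mul_succ ?_
      rintro t ⟨⟨p, hp⟩, hE⟩ htn
      refine ⟨p, hp, ?_⟩
      rintro ⟨w, hw, hwk, hwt⟩
      rcases List.suffix_cons_iff.1 hwt with rfl | hwt
      · simp only [List.length_cons] at hwk
        omega
      · exact hE ⟨w, hw, hwk, hwt⟩
    have h2 := mul_le_mul_of_nonneg_left (hdiff k (n + 1) (by omega)) hc.le
    refine le_trans (le_trans (wordDens_mono ?_) (wordDens_union_le n _ _))
      (add_le_add_right (h1.trans h2) _)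
    rintro t ⟨htD, htp⟩ -
    by_cases hE : t ∈ E k
    · exact Or.inl ⟨htD, hE⟩
    · exact Or.inr ⟨htp, hE⟩
  rw [Metric.tendsto_nhds]
  intro ε hε
  obtain ⟨k, hk⟩ : ∃ k, a - wordDens k Z < ε / (2 * Fintype.card α) := by
    have h := (hlim.eventually (lt_mem_nhds
      (sub_lt_self a (show 0 < ε / (2 * Fintype.card α) by positivity)))).exists
    obtain ⟨k, hk⟩ := h
    exact ⟨k, by linarith⟩
  have hk' : Fintype.card α * (a - wordDens k Z) < ε / 2 := by
    rw [lt_div_iff₀ (by positivity)] at hk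
    linarith
  filter_upwards [(tendsto_wordDens_above_nullNodes U D k).eventually
    (gt_mem_nhds (half_pos hε)), hU (eventually_ge_atTop k)] with n hn hkn
  rw [Real.dist_0_eq_abs, abs_of_nonneg (wordDens_nonneg n _)]
  have := hbound k n hkn
  have hn' : wordDens n (D ∩ E k) < ε / 2 := hn
  linarith

theorem eventually_exists_extension [Nonempty α] {U : Ultrafilter ℕ}
    (hU : (U : Filter ℕ) ≤ atTop) {D : Set (List α)} {w : List α} (hw : w ∉ nullNodes U D) :
    ∀ᶠ n in (U : Filter ℕ), ∃ s ∈ D, s.length = n ∧ w <:+ s ∧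
      ∀ p, p :: s ∉ nullNodes U D := by
  obtain ⟨ε, hε, h⟩ : ∃ ε > 0, ∀ᶠ n in (U : Filter ℕ),
      ε ≤ wordDens n (D ∩ {t | w <:+ t}) := by
    by_contra! hcon
    refine hw (Metric.tendsto_nhds.2 fun ε hε => ?_)
    filter_upwards [hcon ε hε] with n hn
    rw [Real.dist_0_eq_abs, abs_of_nonneg (wordDens_nonneg n _)]
    exact hn
  filter_upwards [h, (tendsto_wordDens_inter_parents_nullNodes hU D).eventually
    (gt_mem_nhds hε)] with n h1 h2
  by_contra! hcon
  refine (h1.trans (wordDens_mono ?_)).not_gt h2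
  rintro t ⟨htD, hwt⟩ htn
  exact ⟨htD, hcon t htD htn hwt⟩

/-- The density theorem for the full tree of words. -/
theorem exists_strong_embedding [Nonempty α] (D : Set (List α))
    (hD : ∃ ε > 0, ∃ᶠ n in atTop, ε ≤ wordDens n D) :
    ∃ (ψ : List α → List α) (l : ℕ → ℕ), StrictMono l ∧ (∀ t, (ψ t).length = l t.length) ∧
      (∀ p t, p :: ψ t <:+ ψ (p :: t)) ∧ ∀ t, ψ t ∈ D := by
  obtain ⟨ε, hε, hfreq⟩ := hD
  have hne : (atTop ⊓ 𝓟 {n | ε ≤ wordDens n D}).NeBot := frequently_mem_iff_neBot.1 hfreq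
  let U : Ultrafilter ℕ := Ultrafilter.of (atTop ⊓ 𝓟 {n | ε ≤ wordDens n D})
  have hUle : (U : Filter ℕ) ≤ atTop ⊓ 𝓟 {n | ε ≤ wordDens n D} := Ultrafilter.of_le _
  have hU : (U : Filter ℕ) ≤ atTop := hUle.trans inf_le_left
  have hnil : ([] : List α) ∉ nullNodes U D := fun h => by
    have h1 : ∀ᶠ n in (U : Filter ℕ), ε ≤ wordDens n D :=
      hUle.trans inf_le_right (mem_principal_self _)
    have h2 : Tendsto (fun n => wordDens n D) U (nhds 0) := by simpa [nullNodes] using h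
    obtain ⟨n, h3, h4⟩ := (h1.and (h2.eventually (gt_mem_nhds hε))).exists
    exact h3.not_gt h4
  have H : ∀ k : ℕ, ∃ N, k ≤ N ∧ ∀ w : List α, ∃ s, w.length ≤ k → w ∉ nullNodes U D →
      s ∈ D ∧ s.length = N ∧ w <:+ s ∧ ∀ p, p :: s ∉ nullNodes U D := fun k => by
    have h1 : ∀ᶠ N in (U : Filter ℕ), ∀ w ∈ {w : List α | w.length ≤ k},
        w ∉ nullNodes U D → ∃ s ∈ D, s.length = N ∧ w <:+ s ∧
          ∀ p, p :: s ∉ nullNodes U D :=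
      (eventually_all_finite (List.finite_length_le α k)).2 fun w _ => by
        by_cases hw : w ∈ nullNodes U D
        · exact Eventually.of_forall fun _ h => absurd hw h
        · exact (eventually_exists_extension hU hw).mono fun _ h _ => h
    obtain ⟨N, hN, hkN⟩ := (h1.and (hU (eventually_ge_atTop k))).exists
    refine ⟨N, hkN, fun w => ?_⟩
    by_cases hw : w.length ≤ k ∧ w ∉ nullNodes U D
    · obtain ⟨s, hs⟩ := hN w hw.1 hw.2
      exact ⟨s, fun _ _ => hs⟩
    · exact ⟨[], fun h h' => absurd ⟨h, h'⟩ hw⟩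
  choose N hkN e he using H
  let l : ℕ → ℕ := fun n => n.rec (N 0) fun _ m => N (m + 1)
  let ψ : List α → List α := fun t =>
    t.rec (e 0 []) fun p _ s => e (s.length + 1) (p :: s)
  have hψ : ∀ t, ψ t ∈ D ∧ (ψ t).length = l t.length ∧ ∀ p, p :: ψ t ∉ nullNodes U D := by
    intro t
    induction t with
    | nil =>
      obtain ⟨h1, h2, -, h3⟩ := he 0 [] le_rfl hnil
      exact ⟨h1, h2, h3⟩
    | cons p t ih =>
      obtain ⟨h1, h2, -, h3⟩ := he ((ψ t).length + 1) (p :: ψ t) le_rfl (ih.2.2 p)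
      refine ⟨h1, h2.trans ?_, h3⟩
      rw [ih.2.1]
      rfl
  refine ⟨ψ, l, strictMono_nat_of_lt_succ fun n => hkN (l n + 1), fun t => (hψ t).2.1,
    fun p t => ?_, fun t => (hψ t).1⟩
  exact (he ((ψ t).length + 1) (p :: ψ t) le_rfl ((hψ t).2.2 p)).2.2.1

end Density

/-- Bicker–Voigt: `DHL(1)`, the one-dimensional density
Halpern–Läuchli theorem. -/
theorem density_halpern_lauchli_one (b : ℕ) (T : Set (List ℕ)) (hT : IsHomogeneous b T)
    (D : Set (List ℕ)) (hD : D ⊆ T)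
    (hdens : 0 < Filter.limsup
      (fun n => ((D ∩ level T n).ncard : ℝ) / ((level T n).ncard : ℝ)) atTop) :
    ∃ S : Set (List ℕ), IsStrongSubtree T S ∧ S ⊆ D := by
  obtain ⟨φ, hφ, rfl⟩ := hT.exists_isTreeEmb
  have : Nonempty (Fin b) := ⟨⟨0, by have := hT.1; omega⟩⟩
  have hratio : ∀ n, ((D ∩ level (Set.range φ) n).ncard : ℝ) / ((level (Set.range φ) n).ncard : ℝ)
      = wordDens n (φ ⁻¹' D) := fun n => by
    have h : D ∩ φ '' {t | t.length = n} = φ '' {t ∈ φ ⁻¹' D | t.length = n} := by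
      ext s
      constructor
      · rintro ⟨hs, t, ht, rfl⟩
        exact ⟨t, ⟨hs, ht⟩, rfl⟩
      · rintro ⟨t, ⟨hs, ht⟩, rfl⟩
        exact ⟨hs, t, ht, rfl⟩
    rw [hφ.level_range, h, Set.ncard_image_of_injective _ hφ.injective,
      Set.ncard_image_of_injective _ hφ.injective, ncard_words, Nat.cast_pow]
    rfl
  simp only [hratio] at hdens
  have hfreq : ∃ ε > 0, ∃ᶠ n in atTop, ε ≤ wordDens n (φ ⁻¹' D) := by
    obtain ⟨ε, hε, hε'⟩ := exists_between hdens
    refine ⟨ε, hε, (frequently_lt_of_lt_limsup ?_ hε').mono fun n h => h.le⟩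
    exact IsCoboundedUnder.of_frequently_ge (a := 0)
      (Frequently.of_forall fun n => wordDens_nonneg n _)
  obtain ⟨ψ, l, hl, hlen, hcons, hmem⟩ := exists_strong_embedding _ hfreq
  refine ⟨Set.range (φ ∘ ψ), hφ.isStrongSubtree_range_comp hcons hl hlen, ?_⟩
  rintro _ ⟨t, rfl⟩
  exact hmem t
end DHLPaper
end

section
/- Let T be a homogeneous tree with branching number b_T, 0 < ε ≤ 1, L an infinite subset of ℕ, and for every n ∈ L let D_n be a subset of T(n) with dens(D_n) ≥ ε. Then there exist k ∈ L, an infinite subset M of L with k < min M, and a node t ∈ D_k such that for every m ∈ M and every p ∈ {0,…,b_T−1}, dens(D_m | t⌢_T p) ≥ ε²/(8 b_T⁴). -/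
open Filter

namespace DHLPaper

/-- The nodes on level `m` of `T` lying above some node of `A`. -/
def cone (T A : Set (List ℕ)) (m : ℕ) : Set (List ℕ) :=
  {u ∈ level T m | ∃ s ∈ A, s <+: u}

theorem finite_strict_preds (T : Set (List ℕ)) (t : List ℕ) :
    {s ∈ T | s <+: t ∧ s ≠ t}.Finite :=
  (t.inits.toFinset.finite_toSet).subset fun s hs => by simpa using hs.2.1

theorem lt_of_mem_level {T : Set (List ℕ)} {s t : List ℕ} {n m : ℕ} (hs : s ∈ level T n)
    (ht : t ∈ level T m) (h : s <+: t) (hne : s ≠ t) : n < m := by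
  obtain ⟨hsT, rfl⟩ := hs
  obtain ⟨-, rfl⟩ := ht
  refine Set.ncard_lt_ncard ⟨?_, fun hsub => ?_⟩ (finite_strict_preds T t)
  · rintro u ⟨hu, hus, hne'⟩
    refine ⟨hu, hus.trans h, ?_⟩
    rintro rfl
    exact hne' (hus.eq_of_length_le h.length_le)
  · exact (hsub ⟨hsT, h, hne⟩ : s ∈ T ∧ s <+: s ∧ s ≠ s).2.2 rfl

theorem prefix_of_common_extension {T : Set (List ℕ)} {s t u : List ℕ} {n m : ℕ}
    (hs : s ∈ level T n) (ht : t ∈ level T m) (hnm : n ≤ m) (hsu : s <+: u) (htu : t <+: u) :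
    s <+: t := by
  rcases List.prefix_or_prefix_of_prefix hsu htu with h | h
  · exact h
  · by_cases hne : t = s
    · exact hne ▸ List.prefix_rfl
    · exact absurd (lt_of_mem_level ht hs h hne) (by omega)

theorem eq_of_common_extension {T : Set (List ℕ)} {s t u : List ℕ} {n : ℕ}
    (hs : s ∈ level T n) (ht : t ∈ level T n) (hsu : s <+: u) (htu : t <+: u) : s = t :=
  (prefix_of_common_extension hs ht le_rfl hsu htu).eq_of_length_le
    (prefix_of_common_extension ht hs le_rfl htu hsu).length_le

theorem ImmSuc.mem_level {T : Set (List ℕ)} {t s : List ℕ} {n : ℕ} (h : ImmSuc T t s)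
    (ht : t ∈ level T n) : s ∈ level T (n + 1) := by
  obtain ⟨htT, hsT, hts, hne, himm⟩ := h
  obtain ⟨-, rfl⟩ := ht
  refine ⟨hsT, ?_⟩
  have : {u ∈ T | u <+: s ∧ u ≠ s} = insert t {u ∈ T | u <+: t ∧ u ≠ t} := by
    ext u
    constructor
    · rintro ⟨hu, hus, hne'⟩
      rcases List.prefix_or_prefix_of_prefix hus hts with h | h
      · by_cases e : u = t
        · exact Or.inl e
        · exact Or.inr ⟨hu, h, e⟩
      · exact Or.inl ((himm u hu h hus).resolve_right hne')
    · rintro (rfl | ⟨hu, hut, hne'⟩)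
      · exact ⟨htT, hts, hne⟩
      · refine ⟨hu, hut.trans hts, ?_⟩
        rintro rfl
        exact hne' (hut.eq_of_length_le hts.length_le)
  rw [this, Set.ncard_insert_of_notMem (fun h => h.2.2 rfl) (finite_strict_preds T t)]

theorem exists_immSuc_of_mem_level {T : Set (List ℕ)} {u : List ℕ} {m : ℕ}
    (hu : u ∈ level T (m + 1)) : ∃ t ∈ level T m, ImmSuc T t u := by
  have hne : {s ∈ T | s <+: u ∧ s ≠ u}.Nonempty := by
    rw [← Set.ncard_pos (finite_strict_preds T u), hu.2]
    omega
  obtain ⟨t, ⟨htT, htu, htne⟩, hmax⟩ :=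
    Set.exists_max_image _ List.length (finite_strict_preds T u) hne
  have himm : ImmSuc T t u := by
    refine ⟨htT, hu.1, htu, htne, fun v hv htv hvu => ?_⟩
    by_cases hvu' : v = u
    · exact Or.inr hvu'
    · exact Or.inl (htv.eq_of_length_le (hmax v ⟨hv, hvu, hvu'⟩)).symm
  have := (himm.mem_level ⟨htT, rfl⟩).2.symm.trans hu.2
  exact ⟨t, ⟨htT, by omega⟩, himm⟩

theorem IsHomogeneous.existsUnique_isConcat {b : ℕ} {T : Set (List ℕ)}
    (hT : IsHomogeneous b T) {t : List ℕ} (ht : t ∈ T) {p : ℕ} (hp : p < b) :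
    ∃! s, IsConcat T t p s := by
  obtain ⟨-, l, hsub, -, -, -, hsucc⟩ := hT
  refine hsucc t ht (t ++ [p]) ⟨hsub ht, ?_, List.prefix_append _ _, by simp, ?_⟩
  · intro x hx
    rcases List.mem_append.1 hx with h | h
    · exact hsub ht x h
    · rwa [List.mem_singleton.1 h]
  · intro u _ htu hup
    rcases List.prefix_concat_iff.1 (by simpa using hup) with h | h
    · exact Or.inr h
    · exact Or.inl (h.eq_of_length_le htu.length_le)

theorem ImmSuc.exists_isConcat {b : ℕ} {T : Set (List ℕ)} (hT : IsHomogeneous b T)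
    {t u : List ℕ} (h : ImmSuc T t u) : ∃ p < b, IsConcat T t p u := by
  obtain ⟨v, rfl⟩ := h.2.2.1
  cases v with
  | nil => exact absurd (by simp) h.2.2.2.1
  | cons p v =>
    obtain ⟨-, l, hsub, -⟩ := hT
    exact ⟨p, hsub h.2.1 p (by simp), h, ⟨v, by simp⟩⟩

/-- The nodes on level `m + 1` whose immediate predecessor lies in `X ⊆ T(m)` are in
bijection with `X × {0,…,b−1}`. -/
theorem IsHomogeneous.finite_and_ncard_succ {b : ℕ} {T : Set (List ℕ)}
    (hT : IsHomogeneous b T) {m : ℕ} {X Y : Set (List ℕ)} (hX : X ⊆ level T m)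
    (hY : Y ⊆ level T (m + 1)) (hfin : X.Finite)
    (h : ∀ t ∈ level T m, ∀ u, ImmSuc T t u → (t ∈ X ↔ u ∈ Y)) :
    Y.Finite ∧ Y.ncard = X.ncard * b := by
  have hex : ∀ t p, ∃ s, t ∈ T → p < b → IsConcat T t p s := by
    intro t p
    by_cases ht : t ∈ T ∧ p < b
    · obtain ⟨s, hs, -⟩ := hT.existsUnique_isConcat ht.1 ht.2
      exact ⟨s, fun _ _ => hs⟩
    · exact ⟨[], fun h1 h2 => absurd ⟨h1, h2⟩ ht⟩
  choose c hc using hex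
  have himage : Y = (fun x : List ℕ × ℕ => c x.1 x.2) '' (X ×ˢ Set.Iio b) := by
    ext u
    constructor
    · intro hu
      obtain ⟨t, ht, himm⟩ := exists_immSuc_of_mem_level (hY hu)
      obtain ⟨p, hp, hconcat⟩ := himm.exists_isConcat hT
      exact ⟨(t, p), ⟨(h t ht u himm).2 hu, hp⟩,
        (hT.existsUnique_isConcat ht.1 hp).unique (hc t p ht.1 hp) hconcat⟩
    · rintro ⟨⟨t, p⟩, ⟨ht, hp⟩, rfl⟩
      exact (h t (hX ht) _ (hc t p (hX ht).1 hp).1).1 ht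
  have hinj : Set.InjOn (fun x : List ℕ × ℕ => c x.1 x.2) (X ×ˢ Set.Iio b) := by
    rintro ⟨t, p⟩ ⟨ht, hp⟩ ⟨t', p'⟩ ⟨ht', hp'⟩ heq
    have h1 := hc t p (hX ht).1 hp
    have h2 := hc t' p' (hX ht').1 hp'
    simp only at heq
    rw [← heq] at h2
    obtain rfl := eq_of_common_extension (hX ht) (hX ht') h1.1.2.2.1 h2.1.2.2.1
    have := (List.prefix_of_prefix_length_le h1.2 h2.2 (by simp)).eq_of_length (by simp)
    simpa using this
  refine ⟨himage ▸ (hfin.prod (Set.finite_Iio b)).image _, ?_⟩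
  rw [himage, hinj.ncard_image, Set.ncard_prod]
  congr 1
  rw [← Finset.coe_Iio, Set.ncard_coe_finset, Nat.card_Iio]

theorem IsHomogeneous.finite_and_ncard_level {b : ℕ} {T : Set (List ℕ)}
    (hT : IsHomogeneous b T) (n : ℕ) : (level T n).Finite ∧ (level T n).ncard = b ^ n := by
  induction n with
  | zero =>
    obtain ⟨-, l, -, ⟨r, hr, huniq⟩, -⟩ := hT
    have : level T 0 = {r} := Set.eq_singleton_iff_unique_mem.2 ⟨hr, huniq⟩
    simp [this]
  | succ n ih =>
    obtain ⟨h1, h2⟩ := hT.finite_and_ncard_succ subset_rfl subset_rfl ih.1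
      fun t ht u hu => ⟨fun _ => hu.mem_level ht, fun _ => ht⟩
    exact ⟨h1, by rw [h2, ih.2, pow_succ]⟩

theorem IsHomogeneous.finite_cone {b : ℕ} {T : Set (List ℕ)} (hT : IsHomogeneous b T)
    (A : Set (List ℕ)) (m : ℕ) : (cone T A m).Finite :=
  (hT.finite_and_ncard_level m).1.subset (Set.sep_subset _ _)

theorem cone_self {T A : Set (List ℕ)} {n : ℕ} (hA : A ⊆ level T n) : cone T A n = A := by
  ext u
  constructor
  · rintro ⟨hu, s, hs, hsu⟩
    exact eq_of_common_extension (hA hs) hu hsu List.prefix_rfl ▸ hs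
  · exact fun hu => ⟨hA hu, u, hu, List.prefix_rfl⟩

theorem mem_cone_iff_of_immSuc {T A : Set (List ℕ)} {n m : ℕ} (hA : A ⊆ level T n)
    (hnm : n ≤ m) {t u : List ℕ} (ht : t ∈ level T m) (h : ImmSuc T t u) :
    t ∈ cone T A m ↔ u ∈ cone T A (m + 1) := by
  constructor
  · rintro ⟨-, s, hs, hst⟩
    exact ⟨h.mem_level ht, s, hs, hst.trans h.2.2.1⟩
  · rintro ⟨-, s, hs, hsu⟩
    exact ⟨ht, s, hs, prefix_of_common_extension (hA hs) ht hnm hsu h.2.2.1⟩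

theorem IsHomogeneous.ncard_cone {b : ℕ} {T : Set (List ℕ)} (hT : IsHomogeneous b T)
    {A : Set (List ℕ)} {n m : ℕ} (hA : A ⊆ level T n) (hnm : n ≤ m) :
    (cone T A m).ncard * b ^ n = A.ncard * b ^ m := by
  induction m, hnm using Nat.le_induction with
  | base => rw [cone_self hA]
  | succ m hnm ih =>
    rw [(hT.finite_and_ncard_succ (X := cone T A m) (Y := cone T A (m + 1))
      (Set.sep_subset _ _) (Set.sep_subset _ _) (hT.finite_cone A m)
      fun t ht u hu => mem_cone_iff_of_immSuc hA hnm ht hu).2, pow_succ, ← mul_assoc, ← ih]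
    ring

theorem cone_union (T A B : Set (List ℕ)) (m : ℕ) :
    cone T (A ∪ B) m = cone T A m ∪ cone T B m := by
  ext u
  simp only [cone, Set.mem_union, Set.mem_ofPred_eq, or_and_right, exists_or, and_or_left]

theorem cone_cone_subset (T A : Set (List ℕ)) (n m : ℕ) :
    cone T (cone T A n) m ⊆ cone T A m := by
  rintro u ⟨hu, s, ⟨-, r, hr, hrs⟩, hsu⟩
  exact ⟨hu, r, hr, hrs.trans hsu⟩

theorem IsHomogeneous.densRel_eq {b : ℕ} {T : Set (List ℕ)} (hT : IsHomogeneous b T)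
    {s : List ℕ} {n m : ℕ} (hs : s ∈ level T n) (hnm : n ≤ m) {F : Set (List ℕ)}
    (hF : F ⊆ level T m) :
    densRel T m F s = (F ∩ cone T {s} m).ncard * (b : ℝ) ^ n / (b : ℝ) ^ m := by
  have hb : (0 : ℝ) < b := by
    have := hT.1
    exact_mod_cast (by omega : 0 < b)
  have h1 : F ∩ suc T s = F ∩ cone T {s} m := by
    ext u
    simp only [suc, cone, Set.mem_inter_iff, Set.mem_ofPred_eq, Set.mem_singleton_iff,
      exists_eq_left]
    exact ⟨fun h => ⟨h.1, hF h.1, h.2.2⟩, fun h => ⟨h.1, h.2.1.1, h.2.2⟩⟩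
  have h2 : level T m ∩ suc T s = cone T {s} m := by
    ext u
    simp only [suc, cone, Set.mem_inter_iff, Set.mem_ofPred_eq, Set.mem_singleton_iff,
      exists_eq_left]
    exact ⟨fun h => ⟨h.1, h.2.2⟩, fun h => ⟨h.1, h.1.1, h.2⟩⟩
  have h3 : ((cone T {s} m).ncard : ℝ) * (b : ℝ) ^ n = (b : ℝ) ^ m := by
    have := hT.ncard_cone (Set.singleton_subset_iff.2 hs) hnm
    rw [Set.ncard_singleton, one_mul] at this
    exact_mod_cast this
  have h4 : ((cone T {s} m).ncard : ℝ) ≠ 0 := by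
    intro h
    rw [h, zero_mul] at h3
    exact (pow_pos hb m).ne h3
  rw [densRel, h1, h2, ← h3]
  field_simp

theorem IsHomogeneous.ncard_inter_cone_le {b : ℕ} {T : Set (List ℕ)} (hT : IsHomogeneous b T)
    {B F : Set (List ℕ)} {n m : ℕ} {θ : ℝ} (hB : B ⊆ level T n) (hnm : n ≤ m)
    (hF : F ⊆ level T m) (h : ∀ s ∈ B, densRel T m F s < θ) :
    ((F ∩ cone T B m).ncard : ℝ) * (b : ℝ) ^ n ≤ θ * B.ncard * (b : ℝ) ^ m := by
  have hb : (0 : ℝ) < b := by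
    have := hT.1
    exact_mod_cast (by omega : 0 < b)
  have hfin : B.Finite := (hT.finite_and_ncard_level n).1.subset hB
  induction B, hfin using Set.Finite.induction_on with
  | empty => simp [cone]
  | @insert a B ha hBfin ih =>
    have ih' := ih ((Set.subset_insert a B).trans hB) fun s hs => h s (Set.mem_insert_of_mem a hs)
    have hbound := h a (Set.mem_insert a B)
    rw [hT.densRel_eq (hB (Set.mem_insert a B)) hnm hF, div_lt_iff₀ (pow_pos hb m)] at hbound
    have hle : ((F ∩ cone T (insert a B) m).ncard : ℝ)
        ≤ (F ∩ cone T {a} m).ncard + (F ∩ cone T B m).ncard := by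
      rw [Set.insert_eq, cone_union, Set.inter_union_distrib_left]
      exact_mod_cast Set.ncard_union_le _ _
    have hmul := mul_le_mul_of_nonneg_right hle (pow_pos hb n).le
    rw [Set.ncard_insert_of_notMem ha hBfin]
    push_cast
    linarith

/-- One step of the density increment: if the sets `D m` have relative density at most `θ`
above `A` eventually along `U`, and every node of `D k` has an immediate successor above which
the sets `D m` have density less than `θ` eventually along `U`, then `A` can be replaced by a set
of larger density with the same property. -/
theorem IsHomogeneous.exists_density_increment {b : ℕ} {T : Set (List ℕ)}
    (hT : IsHomogeneous b T) {D : ℕ → Set (List ℕ)} {ε θ : ℝ} {U : Filter ℕ} [U.NeBot]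
    (hU : U ≤ atTop) (hD : ∀ᶠ m in U, D m ⊆ level T m ∧ ε ≤ dens T m (D m))
    (f : List ℕ → List ℕ)
    (hf : ∀ᶠ k in U, ∀ t ∈ D k,
      ImmSuc T t (f t) ∧ ∀ᶠ m in U, densRel T m (D m) (f t) < θ)
    {n : ℕ} {A : Set (List ℕ)} {c : ℝ} (hA : A ⊆ level T n) (hc : c * (b : ℝ) ^ n ≤ A.ncard)
    (hAD : ∀ᶠ m in U, ((D m ∩ cone T A m).ncard : ℝ) * (b : ℝ) ^ n ≤
      θ * A.ncard * (b : ℝ) ^ m) (hθ : 0 ≤ θ) :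
    ∃ n', ∃ A' ⊆ level T n', (c + (ε - θ) / b) * (b : ℝ) ^ n' ≤ A'.ncard ∧
      ∀ᶠ m in U, ((D m ∩ cone T A' m).ncard : ℝ) * (b : ℝ) ^ n' ≤
        θ * A'.ncard * (b : ℝ) ^ m := by
  have hb : (0 : ℝ) < b := by
    have := hT.1
    exact_mod_cast (by omega : 0 < b)
  obtain ⟨k, ⟨hDk, hεk⟩, hfk, hAk, hnk⟩ :=
    (hD.and (hf.and (hAD.and (hU (eventually_ge_atTop n))))).exists
  have hlevfin := (hT.finite_and_ncard_level k).1
  have hlevcard := (hT.finite_and_ncard_level k).2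
  set E := D k \ cone T A k
  have hEfin : E.Finite := hlevfin.subset (Set.sdiff_subset.trans hDk)
  have hfE : f '' E ⊆ level T (k + 1) := by
    rintro _ ⟨t, ht, rfl⟩
    exact (hfk t ht.1).1.mem_level (hDk ht.1)
  have hinj : Set.InjOn f E := fun t ht t' ht' h =>
    eq_of_common_extension (hDk ht.1) (hDk ht'.1) (hfk t ht.1).1.2.2.1
      (h ▸ (hfk t' ht'.1).1.2.2.1)
  have hdisj : Disjoint (cone T A (k + 1)) (f '' E) := by
    rw [Set.disjoint_right]
    rintro _ ⟨t, ht, rfl⟩ hmem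
    exact ht.2 ((mem_cone_iff_of_immSuc hA hnk (hDk ht.1) (hfk t ht.1).1).2 hmem)
  have hcardA' : ((cone T A (k + 1) ∪ f '' E).ncard : ℝ)
      = (cone T A (k + 1)).ncard + E.ncard := by
    rw [Set.ncard_union_eq hdisj (hT.finite_cone _ _) (hEfin.image f),
      hinj.ncard_image]
    push_cast
    rfl
  have hcone : ((cone T A (k + 1)).ncard : ℝ) * (b : ℝ) ^ n = A.ncard * (b : ℝ) ^ (k + 1) := by
    exact_mod_cast hT.ncard_cone hA (by omega : n ≤ k + 1)
  have hAle : (A.ncard : ℝ) ≤ (b : ℝ) ^ n := by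
    rw [← Nat.cast_pow, ← (hT.finite_and_ncard_level n).2]
    exact_mod_cast Set.ncard_le_ncard hA (hT.finite_and_ncard_level n).1
  have hbn := pow_pos hb n
  have hbk := pow_pos hb k
  refine ⟨k + 1, cone T A (k + 1) ∪ f '' E, Set.union_subset (Set.sep_subset _ _) hfE, ?_, ?_⟩
  · have hEcard : (ε - θ) * (b : ℝ) ^ k ≤ E.ncard := by
      have h1 : ε * (b : ℝ) ^ k ≤ (D k).ncard := by
        rw [dens, hlevcard, Nat.cast_pow, le_div_iff₀ hbk] at hεk
        exact hεk
      have h2 : ((D k ∩ cone T A k).ncard : ℝ) ≤ θ * (b : ℝ) ^ k := by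
        refine le_of_mul_le_mul_right (hAk.trans ?_) hbn
        calc θ * A.ncard * (b : ℝ) ^ k ≤ θ * (b : ℝ) ^ n * (b : ℝ) ^ k := by gcongr
          _ = θ * (b : ℝ) ^ k * (b : ℝ) ^ n := by ring
      have h3 : ((D k ∩ cone T A k).ncard : ℝ) + E.ncard = (D k).ncard := by
        exact_mod_cast Set.ncard_inter_add_ncard_sdiff_eq_ncard (D k) (cone T A k)
          (hlevfin.subset hDk)
      linarith
    have hcone' : c * (b : ℝ) ^ (k + 1) ≤ (cone T A (k + 1)).ncard := by
      refine le_of_mul_le_mul_right ?_ hbn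
      rw [hcone]
      calc c * (b : ℝ) ^ (k + 1) * (b : ℝ) ^ n = c * (b : ℝ) ^ n * (b : ℝ) ^ (k + 1) := by ring
        _ ≤ _ := by gcongr
    have : (ε - θ) / b * (b : ℝ) ^ (k + 1) = (ε - θ) * (b : ℝ) ^ k := by
      rw [pow_succ]
      field_simp
    rw [hcardA', add_mul, this]
    linarith
  · have hall : ∀ᶠ m in U, ∀ t ∈ E, densRel T m (D m) (f t) < θ :=
      (eventually_all_finite hEfin).2 fun t ht => (hfk t ht.1).2
    filter_upwards [hall, hAD, hD, hU (eventually_ge_atTop (k + 1))] with m hm hAm hDm hkm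
    have h1 := hT.ncard_inter_cone_le hfE hkm hDm.1 (by rintro _ ⟨t, ht, rfl⟩; exact hm t ht)
    rw [hinj.ncard_image] at h1
    have h2 : ((D m ∩ cone T (cone T A (k + 1) ∪ f '' E) m).ncard : ℝ)
        ≤ (D m ∩ cone T A m).ncard + (D m ∩ cone T (f '' E) m).ncard := by
      rw [cone_union, Set.inter_union_distrib_left]
      refine (Nat.cast_le.2 (Set.ncard_union_le _ _)).trans ?_
      push_cast
      gcongr
      · exact (hT.finite_cone A m).inter_of_right _
      · exact cone_cone_subset T A (k + 1) m
    have h3 : ((D m ∩ cone T A m).ncard : ℝ) * (b : ℝ) ^ (k + 1)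
        ≤ θ * (cone T A (k + 1)).ncard * (b : ℝ) ^ m := by
      refine le_of_mul_le_mul_right ?_ hbn
      calc ((D m ∩ cone T A m).ncard : ℝ) * (b : ℝ) ^ (k + 1) * (b : ℝ) ^ n
          = (D m ∩ cone T A m).ncard * (b : ℝ) ^ n * (b : ℝ) ^ (k + 1) := by ring
        _ ≤ θ * A.ncard * (b : ℝ) ^ m * (b : ℝ) ^ (k + 1) := by gcongr
        _ = θ * (A.ncard * (b : ℝ) ^ (k + 1)) * (b : ℝ) ^ m := by ring
        _ = θ * (cone T A (k + 1)).ncard * (b : ℝ) ^ m * (b : ℝ) ^ n := by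
          rw [← hcone]
          ring
    have h4 := mul_le_mul_of_nonneg_right h2 (pow_pos hb (k + 1)).le
    rw [hcardA']
    linarith

/-- Lemma A.2. -/
theorem one_dim_correlation_lemma (bT : ℕ) (T : Set (List ℕ)) (hT : IsHomogeneous bT T)
    (ε : ℝ) (hε0 : 0 < ε) (hε1 : ε ≤ 1)
    (L : Set ℕ) (hL : L.Infinite) (D : ℕ → Set (List ℕ))
    (hD : ∀ n ∈ L, D n ⊆ level T n ∧ ε ≤ dens T n (D n)) :
    ∃ k ∈ L, ∃ M ⊆ L, M.Infinite ∧ (∀ m ∈ M, k < m) ∧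
      ∃ t ∈ D k, ∀ m ∈ M, ∀ p < bT, ∀ s, IsConcat T t p s →
        ε ^ 2 / (8 * (bT : ℝ) ^ 4) ≤ densRel T m (D m) s := by
  by_contra hcon
  set θ : ℝ := ε ^ 2 / (8 * (bT : ℝ) ^ 4) with hθ
  have hb2 : (2 : ℝ) ≤ bT := by exact_mod_cast hT.1
  have hb : (0 : ℝ) < bT := by linarith
  have hθ0 : 0 ≤ θ := by positivity
  have hθε : θ < ε := by
    have : (1 : ℝ) ≤ (bT : ℝ) ^ 4 := one_le_pow₀ (by linarith)
    rw [hθ, div_lt_iff₀ (by positivity)]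
    nlinarith
  have : (atTop ⊓ Filter.principal L : Filter ℕ).NeBot := by
    rw [← Nat.cofinite_eq_atTop]
    exact hL.cofinite_inf_principal_neBot
  let U : Ultrafilter ℕ := Ultrafilter.of (atTop ⊓ Filter.principal L)
  have hUle : (U : Filter ℕ) ≤ atTop ⊓ Filter.principal L := Ultrafilter.of_le _
  have hU : (U : Filter ℕ) ≤ atTop := hUle.trans inf_le_left
  have hUL : ∀ᶠ m in (U : Filter ℕ), m ∈ L := hUle (mem_inf_of_right (mem_principal_self L))
  have hbad : ∀ k ∈ L, ∀ t ∈ D k, ∃ s, ImmSuc T t s ∧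
      ∀ᶠ m in (U : Filter ℕ), densRel T m (D m) s < θ := by
    intro k hk t ht
    have htT : t ∈ T := ((hD k hk).1 ht).1
    have hfin : ¬ {m | (m ∈ L ∧ k < m) ∧ ∀ p < bT, ∀ s, IsConcat T t p s →
        θ ≤ densRel T m (D m) s}.Infinite := fun hinf =>
      hcon ⟨k, hk, _, fun m hm => hm.1.1, hinf, fun m hm => hm.1.2, t, ht, fun m hm => hm.2⟩
    have hev := hU (Nat.cofinite_eq_atTop ▸ (Set.not_infinite.1 hfin).compl_mem_cofinite)
    have hex : ∀ᶠ m in (U : Filter ℕ), ∃ p ∈ Set.Iio bT, ∃ s, IsConcat T t p s ∧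
        densRel T m (D m) s < θ := by
      filter_upwards [hev, hUL, hU (eventually_gt_atTop k)] with m hm hmL hkm
      by_contra! hno
      exact hm ⟨⟨hmL, hkm⟩, fun p hp s hs => hno p hp s hs⟩
    rw [Ultrafilter.eventually_exists_mem_iff (Set.finite_Iio bT)] at hex
    obtain ⟨p, hp, hev⟩ := hex
    obtain ⟨s, hs, huniq⟩ := hT.existsUnique_isConcat htT hp
    refine ⟨s, hs.1, hev.mono ?_⟩
    rintro m ⟨s', hs', hlt⟩
    exact huniq s' hs' ▸ hlt
  have hbad' : ∀ t, ∃ s, ∀ k ∈ L, t ∈ D k → ImmSuc T t s ∧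
      ∀ᶠ m in (U : Filter ℕ), densRel T m (D m) s < θ := by
    intro t
    by_cases h : ∃ k ∈ L, t ∈ D k
    · obtain ⟨k, hk, ht⟩ := h
      obtain ⟨s, hs⟩ := hbad k hk t ht
      exact ⟨s, fun _ _ _ => hs⟩
    · exact ⟨[], fun k hk ht => absurd ⟨k, hk, ht⟩ h⟩
  choose f hf using hbad'
  have hiter : ∀ j : ℕ, ∃ n, ∃ A ⊆ level T n, (j * ((ε - θ) / bT)) * (bT : ℝ) ^ n ≤ A.ncard ∧
      ∀ᶠ m in (U : Filter ℕ), ((D m ∩ cone T A m).ncard : ℝ) * (bT : ℝ) ^ n ≤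
        θ * A.ncard * (bT : ℝ) ^ m := by
    intro j
    induction j with
    | zero => exact ⟨0, ∅, Set.empty_subset _, by simp, by simp [cone]⟩
    | succ j ih =>
      obtain ⟨n, A, hA, hc, hAD⟩ := ih
      obtain ⟨n', A', hA', hc', hAD'⟩ := hT.exists_density_increment hU (hUL.mono hD) f
        (hUL.mono fun k hk t ht => hf t k hk ht) hA hc hAD hθ0
      refine ⟨n', A', hA', ?_, hAD'⟩
      push_cast
      rwa [add_mul (j : ℝ), one_mul]
  obtain ⟨j, hj⟩ := exists_nat_gt (1 / ((ε - θ) / bT))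
  obtain ⟨n, A, hA, hc, -⟩ := hiter j
  rw [div_lt_iff₀ (div_pos (sub_pos.2 hθε) hb)] at hj
  have hAle : (A.ncard : ℝ) ≤ (bT : ℝ) ^ n := by
    rw [← Nat.cast_pow, ← (hT.finite_and_ncard_level n).2]
    exact_mod_cast Set.ncard_le_ncard hA (hT.finite_and_ncard_level n).1
  nlinarith [pow_pos hb n]
end DHLPaper
end
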